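/- arXiv:1905.02539 — 3 statements merged into one kernel-verified Lean document; each statement's English description precedes it below -/
import Mathlib

section
/- Let k ≥ 6 be even, let s, w ∈ ℂ satisfy 2 < Re(s) < k−2 and Re(w) < min{Re(s)−1, k−1−Re(s)}, and let z ∈ ℍ². Then ζ_F(1−w+s)·ζ_F(1−w+k−s)·E_{s,k−s}(z;w) = Σ_{𝔫} N(𝔫)^{w−k} · N(𝔫)^{k/2−1} · Σ_{γ ∈ ZΓ\M_𝔫} (K_{k,s}|_k γ)(z), where 𝔫 runs over all nonzero integral ideals of O, all series converging absolutely. (Equivalently, ζ_F(1−w+s)ζ_F(1−w+k−s)E_{s,k−s}(z;w) = Σ_𝔫 N(𝔫)^{w−k} T_𝔫(K_{k,s})(z), with T_𝔫 the 𝔫-th Hecke operator.) -/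
open Complex

noncomputable section

namespace HilbertPaper

/-- Möbius action of a real 2×2 matrix on a complex number. -/
def moebius (g : Matrix (Fin 2) (Fin 2) ℝ) (z : ℂ) : ℂ :=
  (((g 0 0 : ℝ) : ℂ) * z + ((g 0 1 : ℝ) : ℂ)) / (((g 1 0 : ℝ) : ℂ) * z + ((g 1 1 : ℝ) : ℂ))

/-- Automorphy factor `j(g, z) = c z + d`. -/
def jfac (g : Matrix (Fin 2) (Fin 2) ℝ) (z : ℂ) : ℂ :=
  ((g 1 0 : ℝ) : ℂ) * z + ((g 1 1 : ℝ) : ℂ)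

variable (F : Type) [Field F] [NumberField F]

/-- The embedding of the ring of integers into ℝ induced by a real embedding σ of F. -/
def emb (σ : F →+* ℝ) : NumberField.RingOfIntegers F →+* ℝ :=
  σ.comp (algebraMap (NumberField.RingOfIntegers F) F)

/-- An element of F is totally positive when both real embeddings are positive on it. -/
def TotPos (σ₁ σ₂ : F →+* ℝ) (x : F) : Prop := 0 < σ₁ x ∧ 0 < σ₂ x

/-- `F` is a real quadratic field with narrow class number one, whose two real embeddings
are `σ₁ ≠ σ₂`; narrow class number one is expressed as: every nonzero ideal of the ring of
integers has a totally positive generator. -/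
def RealQuadNarrowOne (σ₁ σ₂ : F →+* ℝ) : Prop :=
  Module.finrank ℚ F = 2 ∧ σ₁ ≠ σ₂ ∧
    ∀ I : Ideal (NumberField.RingOfIntegers F), I ≠ ⊥ →
      ∃ a : NumberField.RingOfIntegers F,
        TotPos F σ₁ σ₂ (algebraMap (NumberField.RingOfIntegers F) F a) ∧ I = Ideal.span {a}

/-- Γ = SL₂(O). -/
abbrev SL2O := Matrix.SpecialLinearGroup (Fin 2) (NumberField.RingOfIntegers F)

/-- The real matrix obtained from γ ∈ SL₂(O) by applying σ entrywise. -/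
def mat (σ : F →+* ℝ) (γ : SL2O F) : Matrix (Fin 2) (Fin 2) ℝ :=
  (γ : Matrix (Fin 2) (Fin 2) (NumberField.RingOfIntegers F)).map (emb F σ)

/-- Membership in the subgroup A = {diag(ε, ε⁻¹) : ε a totally positive unit}. -/
def IsInA (σ₁ σ₂ : F →+* ℝ) (a : SL2O F) : Prop :=
  ∃ ε : (NumberField.RingOfIntegers F)ˣ,
    TotPos F σ₁ σ₂ (algebraMap (NumberField.RingOfIntegers F) F (ε : NumberField.RingOfIntegers F)) ∧
    (a : Matrix (Fin 2) (Fin 2) (NumberField.RingOfIntegers F)) =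
      !![(ε : NumberField.RingOfIntegers F), 0; 0, ((ε⁻¹ : (NumberField.RingOfIntegers F)ˣ) : NumberField.RingOfIntegers F)]

/-- The relation on Γ whose quotient is the coset space A\Γ. -/
def ARel (σ₁ σ₂ : F →+* ℝ) (γ γ' : SL2O F) : Prop :=
  ∃ a : SL2O F, IsInA F σ₁ σ₂ a ∧ γ' = a * γ

/-- The summand of the Cohen kernel: (γ₁z₁)^{-s} (γ₂z₂)^{-s} j(γ,z)^{-k·1}. -/
def cohenSummand (σ₁ σ₂ : F →+* ℝ) (k : ℕ) (s : ℂ) (z₁ z₂ : ℂ) (γ : SL2O F) : ℂ :=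
  moebius (mat F σ₁ γ) z₁ ^ (-s) * moebius (mat F σ₂ γ) z₂ ^ (-s) *
    (jfac (mat F σ₁ γ) z₁ ^ (-(k : ℤ)) * jfac (mat F σ₂ γ) z₂ ^ (-(k : ℤ)))

/-- Membership in Γ∞⁺, the upper-triangular elements of Γ with totally positive diagonal. -/
def IsInGammaInfPos (σ₁ σ₂ : F →+* ℝ) (p : SL2O F) : Prop :=
  (p : Matrix (Fin 2) (Fin 2) (NumberField.RingOfIntegers F)) 1 0 = 0 ∧
  TotPos F σ₁ σ₂ (algebraMap (NumberField.RingOfIntegers F) F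
    ((p : Matrix (Fin 2) (Fin 2) (NumberField.RingOfIntegers F)) 0 0)) ∧
  TotPos F σ₁ σ₂ (algebraMap (NumberField.RingOfIntegers F) F
    ((p : Matrix (Fin 2) (Fin 2) (NumberField.RingOfIntegers F)) 1 1))

/-- The relation on Γ whose quotient is the coset space Γ∞⁺\Γ. -/
def GammaInfRel (σ₁ σ₂ : F →+* ℝ) (γ γ' : SL2O F) : Prop :=
  ∃ p : SL2O F, IsInGammaInfPos F σ₁ σ₂ p ∧ γ' = p * γ

/-- The relation on Γ × Γ whose quotient is (Γ∞⁺\Γ)². -/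
def PairRel (σ₁ σ₂ : F →+* ℝ) (p q : SL2O F × SL2O F) : Prop :=
  GammaInfRel F σ₁ σ₂ p.1 q.1 ∧ GammaInfRel F σ₁ σ₂ p.2 q.2

/-- `c_{γδ⁻¹}`, the lower-left entry of γδ⁻¹. -/
def lowc (γ δ : SL2O F) : NumberField.RingOfIntegers F :=
  ((γ * δ⁻¹ : SL2O F) : Matrix (Fin 2) (Fin 2) (NumberField.RingOfIntegers F)) 1 0

/-- The summand of the double Eisenstein series E_{s, k-s}(z; w). -/
def dblSummand (σ₁ σ₂ : F →+* ℝ) (k : ℕ) (s w : ℂ) (z₁ z₂ : ℂ) (γ δ : SL2O F) : ℂ :=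
  ((σ₁ (algebraMap (NumberField.RingOfIntegers F) F (lowc F γ δ)) : ℝ) : ℂ) ^ (w - 1) *
  ((σ₂ (algebraMap (NumberField.RingOfIntegers F) F (lowc F γ δ)) : ℝ) : ℂ) ^ (w - 1) *
  ((jfac (mat F σ₁ γ) z₁ / jfac (mat F σ₁ δ) z₁) ^ (-s) *
   (jfac (mat F σ₂ γ) z₂ / jfac (mat F σ₂ δ) z₂) ^ (-s)) *
  (jfac (mat F σ₁ δ) z₁ ^ (-(k : ℤ)) * jfac (mat F σ₂ δ) z₂ ^ (-(k : ℤ)))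

open Classical in
/-- The summand of the double Eisenstein series, extended by zero to pairs whose
`c_{γδ⁻¹}` is not totally positive. -/
def dblExt (σ₁ σ₂ : F →+* ℝ) (k : ℕ) (s w : ℂ) (z₁ z₂ : ℂ) (γ δ : SL2O F) : ℂ :=
  if TotPos F σ₁ σ₂ (algebraMap (NumberField.RingOfIntegers F) F (lowc F γ δ)) then
    dblSummand F σ₁ σ₂ k s w z₁ z₂ γ δ
  else 0

/-- The value of the Dedekind zeta function of F at `u` (for `Re u > 1`), as the absolutely
convergent sum over nonzero integral ideals of `N(𝔞)^{-u}`. -/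
def zetaVal (u : ℂ) : ℂ :=
  ∑' I : {I : Ideal (NumberField.RingOfIntegers F) // I ≠ ⊥}, (Ideal.absNorm I.1 : ℂ) ^ (-u)

/-- `M_𝔫`: 2×2 matrices over O with totally positive determinant generating the ideal 𝔫. -/
def Mn (σ₁ σ₂ : F →+* ℝ) (I : Ideal (NumberField.RingOfIntegers F)) :=
  {m : Matrix (Fin 2) (Fin 2) (NumberField.RingOfIntegers F) //
    TotPos F σ₁ σ₂ (algebraMap (NumberField.RingOfIntegers F) F m.det) ∧
    Ideal.span {m.det} = I}

/-- The relation on `M_𝔫` whose quotient is the coset space `ZΓ\M_𝔫`. -/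
def MnRel (σ₁ σ₂ : F →+* ℝ) (I : Ideal (NumberField.RingOfIntegers F))
    (m m' : Mn F σ₁ σ₂ I) : Prop :=
  ∃ (u : (NumberField.RingOfIntegers F)ˣ) (γ : SL2O F),
    m'.1 = (u : NumberField.RingOfIntegers F) •
      ((γ : Matrix (Fin 2) (Fin 2) (NumberField.RingOfIntegers F)) * m.1)

/-- The weight-k slash of a function `K : ℍ² → ℂ` by a matrix `m` over O with totally positive
determinant: `(K|_k m)(z) = N(det m)^{k/2} j(m,z)^{-k·1} K(m·z)`. -/
def slashSummand (σ₁ σ₂ : F →+* ℝ) (k : ℕ) (K : ℂ → ℂ → ℂ) (z₁ z₂ : ℂ)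
    (m : Matrix (Fin 2) (Fin 2) (NumberField.RingOfIntegers F)) : ℂ :=
  ((emb F σ₁ m.det * emb F σ₂ m.det : ℝ) : ℂ) ^ (k / 2) *
  (jfac (m.map (emb F σ₁)) z₁ ^ (-(k : ℤ)) * jfac (m.map (emb F σ₂)) z₂ ^ (-(k : ℤ))) *
  K (moebius (m.map (emb F σ₁)) z₁) (moebius (m.map (emb F σ₂)) z₂)

set_option linter.unusedSectionVars false

lemma emb_injective (σ : F →+* ℝ) : Function.Injective (emb F σ) :=
  σ.injective.comp NumberField.RingOfIntegers.coe_injective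

lemma norm_eq_mul {σ₁ σ₂ : F →+* ℝ} (hdeg : Module.finrank ℚ F = 2) (hne : σ₁ ≠ σ₂) (x : F) :
    ((Algebra.norm ℚ x : ℚ) : ℝ) = σ₁ x * σ₂ x := by
  classical
  let φ : (F →+* ℝ) → (F →ₐ[ℚ] ℂ) := fun σ => (Complex.ofRealHom.comp σ).toRatAlgHom
  have hφ : ∀ σ y, φ σ y = (σ y : ℂ) := fun σ y => rfl
  have hφne : φ σ₁ ≠ φ σ₂ := by
    intro h
    apply hne
    ext y
    have := DFunLike.congr_fun h y
    rw [hφ, hφ] at this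
    exact_mod_cast this
  have hcard : Fintype.card (F →ₐ[ℚ] ℂ) = 2 := by
    rw [AlgHom.card, hdeg]
  have huniv : (Finset.univ : Finset (F →ₐ[ℚ] ℂ)) = {φ σ₁, φ σ₂} := by
    symm
    apply Finset.eq_univ_of_card
    rw [Finset.card_pair hφne, hcard]
  have h := Algebra.norm_eq_prod_embeddings ℚ ℂ x
  rw [huniv, Finset.prod_pair hφne, hφ, hφ] at h
  have h2 : (((Algebra.norm ℚ x : ℚ) : ℝ) : ℂ) = ((σ₁ x * σ₂ x : ℝ) : ℂ) := by
    push_cast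
    simpa using h
  exact_mod_cast h2

lemma absNorm_span_eq {σ₁ σ₂ : F →+* ℝ} (hdeg : Module.finrank ℚ F = 2) (hne : σ₁ ≠ σ₂)
    (a : NumberField.RingOfIntegers F) :
    (Ideal.absNorm (Ideal.span {a}) : ℝ) = |emb F σ₁ a * emb F σ₂ a| := by
  have h := norm_eq_mul F hdeg hne (algebraMap (NumberField.RingOfIntegers F) F a)
  have h2 : Algebra.norm ℚ (algebraMap (NumberField.RingOfIntegers F) F a)
      = ((Algebra.norm ℤ a : ℤ) : ℚ) := (Algebra.coe_norm_int a).symm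
  rw [h2] at h
  rw [Ideal.absNorm_span_singleton]
  change _ = |σ₁ _ * σ₂ _|
  rw [← h]
  simp [Nat.cast_natAbs]

lemma one_le_abs_emb_mul {σ₁ σ₂ : F →+* ℝ} (hdeg : Module.finrank ℚ F = 2) (hne : σ₁ ≠ σ₂)
    {a : NumberField.RingOfIntegers F} (ha : a ≠ 0) : 1 ≤ |emb F σ₁ a * emb F σ₂ a| := by
  rw [← absNorm_span_eq F hdeg hne]
  have : Ideal.absNorm (Ideal.span {a}) ≠ 0 := by
    rw [Ne, Ideal.absNorm_eq_zero_iff, Ideal.span_singleton_eq_bot]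
    exact ha
  exact_mod_cast Nat.one_le_iff_ne_zero.mpr this

lemma abs_emb_mul_unit {σ₁ σ₂ : F →+* ℝ} (hdeg : Module.finrank ℚ F = 2) (hne : σ₁ ≠ σ₂)
    (u : (NumberField.RingOfIntegers F)ˣ) :
    |emb F σ₁ (u : NumberField.RingOfIntegers F) * emb F σ₂ (u : NumberField.RingOfIntegers F)|
      = 1 := by
  rw [← absNorm_span_eq F hdeg hne, Ideal.span_singleton_eq_top.mpr u.isUnit]
  simp

lemma rank_eq_one {σ₁ : F →+* ℝ} (hdeg : Module.finrank ℚ F = 2) :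
    NumberField.Units.rank F = 1 := by
  have h1 := NumberField.InfinitePlace.card_add_two_mul_card_eq_rank F
  have h2 := NumberField.InfinitePlace.card_eq_nrRealPlaces_add_nrComplexPlaces F
  have h3 : 0 < NumberField.InfinitePlace.nrRealPlaces F := by
    classical
    rw [← NumberField.InfinitePlace.card_real_embeddings]
    refine Fintype.card_pos_iff.mpr ⟨⟨Complex.ofRealHom.comp σ₁, ?_⟩⟩
    rw [NumberField.ComplexEmbedding.isReal_iff]
    ext x
    simp
  unfold NumberField.Units.rank
  omega

lemma eq_one_or_neg_one_of_abs_emb {σ : F →+* ℝ} {u : (NumberField.RingOfIntegers F)ˣ}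
    (h : |emb F σ (u : NumberField.RingOfIntegers F)| = 1) : u = 1 ∨ u = -1 := by
  rcases (abs_eq zero_le_one).mp h with h | h
  · left
    ext1
    apply emb_injective F σ
    simpa using h
  · right
    ext1
    apply emb_injective F σ
    simpa using h

/-- A unit such that every unit is, up to sign, one of its powers. -/
lemma exists_fund_unit (σ₁ : F →+* ℝ) (hdeg : Module.finrank ℚ F = 2) :
    ∃ ε : (NumberField.RingOfIntegers F)ˣ,
      |emb F σ₁ (ε : NumberField.RingOfIntegers F)| ≠ 1 ∧
      ∀ u : (NumberField.RingOfIntegers F)ˣ, ∃ m : ℤ, u = ε ^ m ∨ u = -ε ^ m := by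
  have hr := rank_eq_one F (σ₁ := σ₁) hdeg
  have : Unique (Fin (NumberField.Units.rank F)) := by rw [hr]; infer_instance
  have htors : ∀ ζ ∈ NumberField.Units.torsion F, ζ = 1 ∨ ζ = -1 := by
    intro ζ hζ
    apply eq_one_or_neg_one_of_abs_emb F (σ := σ₁)
    obtain ⟨n, hn, h⟩ := isOfFinOrder_iff_pow_eq_one.mp
      ((CommGroup.mem_torsion _).mp hζ)
    have h3 : |emb F σ₁ (ζ : NumberField.RingOfIntegers F)| ^ n = 1 := by
      rw [← abs_pow, ← map_pow, ← Units.val_pow_eq_pow_val, h]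
      simp
    exact (pow_eq_one_iff_of_nonneg (abs_nonneg _) hn.ne').mp h3
  refine ⟨NumberField.Units.fundSystem F default, ?_, ?_⟩
  · intro h
    have hmem : NumberField.Units.fundSystem F default ∈ NumberField.Units.torsion F := by
      rcases eq_one_or_neg_one_of_abs_emb F h with h | h
      · rw [h]; exact one_mem _
      · rw [h]
        exact (CommGroup.mem_torsion _).mpr
          (isOfFinOrder_iff_pow_eq_one.mpr ⟨2, by norm_num, by simp⟩)
    obtain ⟨p, -, hp⟩ := NumberField.Units.exist_unique_eq_mul_prod F
      (NumberField.Units.fundSystem F default)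
    have h1 := hp (⟨_, hmem⟩, fun _ => 0) (by simp)
    have h2 := hp (1, fun _ => 1) (by simp)
    have h3 := congrFun (congrArg Prod.snd (h1.trans h2.symm)) default
    exact zero_ne_one h3
  · intro u
    obtain ⟨⟨ζ, e⟩, h, -⟩ := NumberField.Units.exist_unique_eq_mul_prod F u
    refine ⟨e default, ?_⟩
    simp only [Fintype.prod_unique] at h
    rcases htors ζ ζ.2 with h' | h'
    · left; rw [h, h']; simp
    · right; rw [h, h']; simp

lemma exists_mixed_sign {σ₁ σ₂ : F →+* ℝ} (hne : σ₁ ≠ σ₂) :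
    ∃ a : NumberField.RingOfIntegers F, emb F σ₁ a * emb F σ₂ a < 0 := by
  obtain ⟨x, hx⟩ : ∃ x, σ₁ x ≠ σ₂ x := by
    by_contra! h
    exact hne (RingHom.ext h)
  obtain ⟨y, hy⟩ : ∃ y, σ₁ y * σ₂ y < 0 := by
    rcases lt_or_gt_of_ne hx with h | h
    · obtain ⟨r, hr1, hr2⟩ := exists_rat_btwn h
      refine ⟨x - (r : F), ?_⟩
      rw [map_sub, map_sub, map_ratCast, map_ratCast]
      exact mul_neg_of_neg_of_pos (by linarith) (by linarith)
    · obtain ⟨r, hr1, hr2⟩ := exists_rat_btwn h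
      refine ⟨x - (r : F), ?_⟩
      rw [map_sub, map_sub, map_ratCast, map_ratCast]
      exact mul_neg_of_pos_of_neg (by linarith) (by linarith)
  obtain ⟨a, b, hb, rfl⟩ := IsFractionRing.div_surjective (A := NumberField.RingOfIntegers F) y
  refine ⟨a * b, ?_⟩
  have hb0 : b ≠ 0 := nonZeroDivisors.ne_zero hb
  have e1 : emb F σ₁ b ≠ 0 := (map_ne_zero_iff _ (emb_injective F σ₁)).mpr hb0
  have e2 : emb F σ₂ b ≠ 0 := (map_ne_zero_iff _ (emb_injective F σ₂)).mpr hb0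
  rw [map_div₀, map_div₀] at hy
  change emb F σ₁ a / emb F σ₁ b * (emb F σ₂ a / emb F σ₂ b) < 0 at hy
  have : emb F σ₁ (a * b) * emb F σ₂ (a * b) =
      emb F σ₁ a / emb F σ₁ b * (emb F σ₂ a / emb F σ₂ b) *
        (emb F σ₁ b * emb F σ₂ b) ^ 2 := by
    rw [map_mul, map_mul]
    field_simp
  rw [this]
  exact mul_neg_of_neg_of_pos hy (by positivity)

lemma exists_mixed_sign_unit {σ₁ σ₂ : F →+* ℝ} (hF : RealQuadNarrowOne F σ₁ σ₂) :
    ∃ u : (NumberField.RingOfIntegers F)ˣ,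
      emb F σ₁ (u : NumberField.RingOfIntegers F) * emb F σ₂ (u : NumberField.RingOfIntegers F)
        < 0 := by
  obtain ⟨a, ha⟩ := exists_mixed_sign F hF.2.1
  have ha0 : a ≠ 0 := by rintro rfl; simp at ha
  obtain ⟨b, hb, h⟩ := hF.2.2 (Ideal.span {a}) (by simpa using ha0)
  obtain ⟨u, hu⟩ := Ideal.span_singleton_eq_span_singleton.mp h.symm
  refine ⟨u, ?_⟩
  have hb1 : 0 < emb F σ₁ b := hb.1
  have hb2 : 0 < emb F σ₂ b := hb.2
  rw [← hu, map_mul, map_mul] at ha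
  by_contra! hcon
  have := mul_nonneg (mul_pos hb1 hb2).le hcon
  linarith

/-- Every totally positive unit is a square. -/
lemma exists_sq_of_totPos {σ₁ σ₂ : F →+* ℝ} (hF : RealQuadNarrowOne F σ₁ σ₂)
    (ε : (NumberField.RingOfIntegers F)ˣ)
    (h1 : 0 < emb F σ₁ (ε : NumberField.RingOfIntegers F))
    (h2 : 0 < emb F σ₂ (ε : NumberField.RingOfIntegers F)) :
    ∃ v : (NumberField.RingOfIntegers F)ˣ, ε = v ^ 2 := by
  obtain ⟨η, -, hη⟩ := exists_fund_unit F σ₁ hF.1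
  obtain ⟨u, hu⟩ := exists_mixed_sign_unit F hF
  let N : (NumberField.RingOfIntegers F)ˣ →* ℝˣ :=
    Units.map (emb F σ₁ : NumberField.RingOfIntegers F →* ℝ) *
      Units.map (emb F σ₂ : NumberField.RingOfIntegers F →* ℝ)
  have hN : ∀ x, ((N x : ℝˣ) : ℝ) = emb F σ₁ (x : NumberField.RingOfIntegers F) *
      emb F σ₂ (x : NumberField.RingOfIntegers F) := fun x => rfl
  have hNneg : ∀ x, N (-x) = N x := by
    intro x; ext; simp [hN]
  have hNabs := abs_emb_mul_unit F hF.1 hF.2.1 η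
  rw [← hN] at hNabs hu
  have hη1 : N η = -1 := by
    rcases (abs_eq zero_le_one).mp hNabs with h | h
    · have h1 : N η = 1 := by ext; exact h
      exfalso
      obtain ⟨m, hm | hm⟩ := hη u
      · rw [hm, map_zpow, h1, one_zpow] at hu; norm_num at hu
      · rw [hm, hNneg, map_zpow, h1, one_zpow] at hu; norm_num at hu
    · ext; simpa using h
  have hε : 0 < ((N ε : ℝˣ) : ℝ) := by rw [hN]; positivity
  obtain ⟨m, hm⟩ := hη ε
  have hNm : N ε = (-1) ^ m := by
    rcases hm with hm | hm
    · rw [hm, map_zpow, hη1]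
    · rw [hm, hNneg, map_zpow, hη1]
  have hev : Even m := by
    by_contra hodd
    rw [hNm, (Int.not_even_iff_odd.mp hodd).neg_one_zpow] at hε
    norm_num at hε
  obtain ⟨l, rfl⟩ := hev
  refine ⟨η ^ l, ?_⟩
  rw [zpow_add, ← sq] at hm
  rcases hm with hm | hm
  · exact hm
  · exfalso
    rw [hm] at h1
    simp only [Units.val_neg, Units.val_pow_eq_pow_val, map_neg, map_pow] at h1
    nlinarith [sq_nonneg (emb F σ₁ ((η ^ l : (NumberField.RingOfIntegers F)ˣ) :
      NumberField.RingOfIntegers F))]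

lemma exists_totPos_unit_gt_one {σ₁ σ₂ : F →+* ℝ} (hF : RealQuadNarrowOne F σ₁ σ₂) :
    ∃ ε : (NumberField.RingOfIntegers F)ˣ,
      1 < emb F σ₁ (ε : NumberField.RingOfIntegers F) ∧
      0 < emb F σ₂ (ε : NumberField.RingOfIntegers F) := by
  obtain ⟨η, hη, -⟩ := exists_fund_unit F σ₁ hF.1
  have key : ∀ u : (NumberField.RingOfIntegers F)ˣ,
      1 < |emb F σ₁ (u : NumberField.RingOfIntegers F)| →
      1 < emb F σ₁ ((u ^ 2 : (NumberField.RingOfIntegers F)ˣ) : NumberField.RingOfIntegers F) ∧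
      0 < emb F σ₂ ((u ^ 2 : (NumberField.RingOfIntegers F)ˣ) :
        NumberField.RingOfIntegers F) := by
    intro u hu
    simp only [Units.val_pow_eq_pow_val, map_pow]
    refine ⟨by rw [← sq_abs]; exact one_lt_pow₀ hu two_ne_zero, ?_⟩
    have : emb F σ₂ (u : NumberField.RingOfIntegers F) ≠ 0 :=
      (u.isUnit.map (emb F σ₂)).ne_zero
    positivity
  rcases lt_or_gt_of_ne hη with h | h
  · refine ⟨(η⁻¹) ^ 2, key _ ?_⟩
    have h1 : emb F σ₁ (η : NumberField.RingOfIntegers F) *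
        emb F σ₁ ((η⁻¹ : (NumberField.RingOfIntegers F)ˣ) : NumberField.RingOfIntegers F) = 1 := by
      rw [← map_mul]; simp
    have h2 := congrArg abs h1
    rw [abs_mul, abs_one] at h2
    by_contra! hle
    have h3 := abs_nonneg (emb F σ₁ (η : NumberField.RingOfIntegers F))
    nlinarith
  · exact ⟨_, key _ h⟩

/-- The linear form `v₀ z + v₁` attached to a row vector `v` over `O`. -/
def lin (σ : F →+* ℝ) (v : Fin 2 → NumberField.RingOfIntegers F) (z : ℂ) : ℂ :=
  ((emb F σ (v 0) : ℝ) : ℂ) * z + ((emb F σ (v 1) : ℝ) : ℂ)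

/-- The determinant of the matrix with rows `x` and `y`. -/
def rowDet (x y : Fin 2 → NumberField.RingOfIntegers F) : NumberField.RingOfIntegers F :=
  x 0 * y 1 - x 1 * y 0

/-- Two rows are related when they differ by a totally positive unit. -/
def RowRel (σ₁ σ₂ : F →+* ℝ) (v v' : {v : Fin 2 → NumberField.RingOfIntegers F // v ≠ 0}) :
    Prop :=
  ∃ ε : (NumberField.RingOfIntegers F)ˣ,
    0 < emb F σ₁ (ε : NumberField.RingOfIntegers F) ∧
    0 < emb F σ₂ (ε : NumberField.RingOfIntegers F) ∧
    v'.1 = (ε : NumberField.RingOfIntegers F) • v.1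

lemma emb_unit_inv_pos {σ : F →+* ℝ} {ε : (NumberField.RingOfIntegers F)ˣ}
    (h : 0 < emb F σ (ε : NumberField.RingOfIntegers F)) :
    0 < emb F σ ((ε⁻¹ : (NumberField.RingOfIntegers F)ˣ) : NumberField.RingOfIntegers F) := by
  have h1 : emb F σ (ε : NumberField.RingOfIntegers F) *
      emb F σ ((ε⁻¹ : (NumberField.RingOfIntegers F)ˣ) : NumberField.RingOfIntegers F) = 1 := by
    rw [← map_mul]; simp
  exact pos_of_mul_pos_right (by rw [h1]; exact one_pos) h.le

lemma emb_mul_unit_eq_one {σ₁ σ₂ : F →+* ℝ} (hF : RealQuadNarrowOne F σ₁ σ₂)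
    {ε : (NumberField.RingOfIntegers F)ˣ}
    (h1 : 0 < emb F σ₁ (ε : NumberField.RingOfIntegers F))
    (h2 : 0 < emb F σ₂ (ε : NumberField.RingOfIntegers F)) :
    emb F σ₁ (ε : NumberField.RingOfIntegers F) * emb F σ₂ (ε : NumberField.RingOfIntegers F)
      = 1 := by
  rw [← abs_emb_mul_unit F hF.1 hF.2.1 ε, abs_of_pos (mul_pos h1 h2)]

lemma rowRel_equivalence (σ₁ σ₂ : F →+* ℝ) : Equivalence (RowRel F σ₁ σ₂) where
  refl v := ⟨1, by simp, by simp, by simp⟩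
  symm := by
    rintro v v' ⟨ε, h1, h2, h⟩
    exact ⟨ε⁻¹, emb_unit_inv_pos F h1, emb_unit_inv_pos F h2, by rw [h, smul_smul]; simp⟩
  trans := by
    rintro v v' v'' ⟨ε, h1, h2, h⟩ ⟨ε', h1', h2', h'⟩
    refine ⟨ε' * ε, ?_, ?_, by rw [h', h, smul_smul]; simp⟩
    · rw [Units.val_mul, map_mul]; exact mul_pos h1' h1
    · rw [Units.val_mul, map_mul]; exact mul_pos h2' h2

lemma rowDet_smul (a b : NumberField.RingOfIntegers F)
    (x y : Fin 2 → NumberField.RingOfIntegers F) :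
    rowDet F (a • x) (b • y) = a * b * rowDet F x y := by
  simp only [rowDet, Pi.smul_apply, smul_eq_mul]; ring

lemma lin_smul (σ : F →+* ℝ) (a : NumberField.RingOfIntegers F)
    (v : Fin 2 → NumberField.RingOfIntegers F) (z : ℂ) :
    lin F σ (a • v) z = ((emb F σ a : ℝ) : ℂ) * lin F σ v z := by
  simp only [lin, Pi.smul_apply, smul_eq_mul, map_mul, Complex.ofReal_mul]; ring

lemma lin_ne_zero (σ : F →+* ℝ) {v : Fin 2 → NumberField.RingOfIntegers F} (hv : v ≠ 0)
    {z : ℂ} (hz : 0 < z.im) : lin F σ v z ≠ 0 := by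
  intro h
  have him := congrArg Complex.im h
  have hre := congrArg Complex.re h
  simp only [lin, Complex.add_im, Complex.im_ofReal_mul, Complex.ofReal_im, add_zero,
    Complex.zero_im, mul_eq_zero, hz.ne', or_false, map_eq_zero_iff _ (emb_injective F σ)] at him
  simp only [lin, him, map_zero, Complex.ofReal_zero, zero_mul, zero_add, Complex.ofReal_re,
    Complex.zero_re, map_eq_zero_iff _ (emb_injective F σ)] at hre
  apply hv
  ext i
  fin_cases i
  · simp [him]
  · simp [hre]

lemma lin_mul_conj_im (σ : F →+* ℝ) (x y : Fin 2 → NumberField.RingOfIntegers F) (z : ℂ) :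
    (lin F σ x z * (starRingEnd ℂ) (lin F σ y z)).im = emb F σ (rowDet F x y) * z.im := by
  simp [lin, rowDet]
  ring

lemma lin_div_im_pos (σ : F →+* ℝ) {x y : Fin 2 → NumberField.RingOfIntegers F} {z : ℂ}
    (hz : 0 < z.im) (hdet : 0 < emb F σ (rowDet F x y)) :
    0 < (lin F σ x z / lin F σ y z).im := by
  have hy : y ≠ 0 := by rintro rfl; simp [rowDet] at hdet
  have hl := lin_ne_zero F σ hy hz
  rw [div_eq_mul_inv, Complex.inv_def, ← mul_assoc, Complex.im_mul_ofReal,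
    lin_mul_conj_im]
  have := Complex.normSq_pos.mpr hl
  positivity

lemma ofReal_mul_cpow {r : ℝ} (hr : 0 < r) {x : ℂ} (hx : x ≠ 0) (u : ℂ) :
    ((r : ℂ) * x) ^ u = (r : ℂ) ^ u * x ^ u := by
  have hr' : (r : ℂ) ≠ 0 := by exact_mod_cast hr.ne'
  rw [Complex.cpow_def_of_ne_zero (mul_ne_zero hr' hx), Complex.cpow_def_of_ne_zero hr',
    Complex.cpow_def_of_ne_zero hx, Complex.log_ofReal_mul hr hx, Complex.ofReal_log hr.le,
    add_mul, Complex.exp_add]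

open Classical in
/-- The summand of the double Eisenstein series as a function of an arbitrary pair of rows. -/
def rowSummand (σ₁ σ₂ : F →+* ℝ) (k : ℕ) (s w z₁ z₂ : ℂ)
    (x y : Fin 2 → NumberField.RingOfIntegers F) : ℂ :=
  if 0 < emb F σ₁ (rowDet F x y) ∧ 0 < emb F σ₂ (rowDet F x y) then
    ((emb F σ₁ (rowDet F x y) : ℝ) : ℂ) ^ (w - 1) * ((emb F σ₂ (rowDet F x y) : ℝ) : ℂ) ^ (w - 1) *
    ((lin F σ₁ x z₁ / lin F σ₁ y z₁) ^ (-s) * (lin F σ₂ x z₂ / lin F σ₂ y z₂) ^ (-s)) *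
    (lin F σ₁ y z₁ ^ (-(k : ℤ)) * lin F σ₂ y z₂ ^ (-(k : ℤ)))
  else 0

lemma rowDet_ne_zero_left {σ : F →+* ℝ} {x y : Fin 2 → NumberField.RingOfIntegers F}
    (h : 0 < emb F σ (rowDet F x y)) : x ≠ 0 := by
  rintro rfl; simp [rowDet] at h

lemma rowDet_ne_zero_right {σ : F →+* ℝ} {x y : Fin 2 → NumberField.RingOfIntegers F}
    (h : 0 < emb F σ (rowDet F x y)) : y ≠ 0 := by
  rintro rfl; simp [rowDet] at h

/-- The one-place scaling identity behind `rowSummand_smul`. -/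
lemma factor_smul {a b d : ℝ} (ha : 0 < a) (hb : 0 < b) (hd : 0 < d) {j l : ℂ} (hj : j ≠ 0)
    (hl : l ≠ 0) (k : ℕ) (s w : ℂ) :
    ((a * b * d : ℝ) : ℂ) ^ (w - 1) * (((a : ℂ) * j) / ((b : ℂ) * l)) ^ (-s) *
      ((b : ℂ) * l) ^ (-(k : ℤ)) =
    (a : ℂ) ^ (w - 1 - s) * (b : ℂ) ^ (w - 1 + s - k) *
      ((d : ℂ) ^ (w - 1) * (j / l) ^ (-s) * l ^ (-(k : ℤ))) := by
  have ha' : (a : ℂ) ≠ 0 := by exact_mod_cast ha.ne'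
  have hb' : (b : ℂ) ≠ 0 := by exact_mod_cast hb.ne'
  have hd' : (d : ℂ) ≠ 0 := by exact_mod_cast hd.ne'
  have e1 : ((a : ℂ) * j) / ((b : ℂ) * l) = (a : ℂ) * ((b⁻¹ : ℝ) * (j / l)) := by
    push_cast; field_simp
  have hbi : ((b⁻¹ : ℝ) : ℂ) ^ (-s) = (b : ℂ) ^ s := by
    rw [Complex.ofReal_inv, Complex.inv_cpow, Complex.cpow_neg, inv_inv]
    rw [Complex.arg_ofReal_of_nonneg hb.le]
    exact Real.pi_pos.ne
  rw [e1, ofReal_mul_cpow ha (mul_ne_zero (by exact_mod_cast (inv_pos.mpr hb).ne')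
    (div_ne_zero hj hl)), ofReal_mul_cpow (inv_pos.mpr hb) (div_ne_zero hj hl), hbi,
    Complex.ofReal_mul, Complex.ofReal_mul, mul_assoc (a : ℂ), ofReal_mul_cpow ha
    (mul_ne_zero hb' hd'), ofReal_mul_cpow hb hd', mul_zpow]
  have e2 : (b : ℂ) ^ (-(k : ℤ)) = (b : ℂ) ^ (-(k : ℂ)) := by
    rw [← Complex.cpow_intCast]; push_cast; rfl
  rw [e2, show w - 1 - s = (w - 1) + (-s) by ring, show w - 1 + s - k = (w - 1) + s + (-(k : ℂ)) by ring,
    Complex.cpow_add _ _ ha', Complex.cpow_add _ _ hb', Complex.cpow_add _ _ hb']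
  ring

lemma rowSummand_smul (σ₁ σ₂ : F →+* ℝ) (k : ℕ) (s w : ℂ) {z₁ z₂ : ℂ} (hz₁ : 0 < z₁.im)
    (hz₂ : 0 < z₂.im) {a b : NumberField.RingOfIntegers F}
    (ha₁ : 0 < emb F σ₁ a) (ha₂ : 0 < emb F σ₂ a) (hb₁ : 0 < emb F σ₁ b) (hb₂ : 0 < emb F σ₂ b)
    (x y : Fin 2 → NumberField.RingOfIntegers F) :
    rowSummand F σ₁ σ₂ k s w z₁ z₂ (a • x) (b • y) =
      ((emb F σ₁ a * emb F σ₂ a : ℝ) : ℂ) ^ (w - 1 - s) *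
      ((emb F σ₁ b * emb F σ₂ b : ℝ) : ℂ) ^ (w - 1 + s - k) *
      rowSummand F σ₁ σ₂ k s w z₁ z₂ x y := by
  have hc : (0 < emb F σ₁ (rowDet F (a • x) (b • y)) ∧ 0 < emb F σ₂ (rowDet F (a • x) (b • y))) ↔
      (0 < emb F σ₁ (rowDet F x y) ∧ 0 < emb F σ₂ (rowDet F x y)) := by
    simp only [rowDet_smul, map_mul, mul_pos_iff_of_pos_left (mul_pos ha₁ hb₁),
      mul_pos_iff_of_pos_left (mul_pos ha₂ hb₂)]
  unfold rowSummand
  by_cases h : 0 < emb F σ₁ (rowDet F x y) ∧ 0 < emb F σ₂ (rowDet F x y)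
  · rw [if_pos h, if_pos (hc.mpr h)]
    have hx := rowDet_ne_zero_left F h.1
    have hy := rowDet_ne_zero_right F h.1
    have f1 := factor_smul ha₁ hb₁ h.1 (lin_ne_zero F σ₁ hx hz₁) (lin_ne_zero F σ₁ hy hz₁) k s w
    have f2 := factor_smul ha₂ hb₂ h.2 (lin_ne_zero F σ₂ hx hz₂) (lin_ne_zero F σ₂ hy hz₂) k s w
    simp only [rowDet_smul, lin_smul, map_mul]
    have ha2 : ((emb F σ₂ a : ℝ) : ℂ) ≠ 0 := by exact_mod_cast ha₂.ne'
    have hb2 : ((emb F σ₂ b : ℝ) : ℂ) ≠ 0 := by exact_mod_cast hb₂.ne'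
    rw [Complex.ofReal_mul (emb F σ₁ a), Complex.ofReal_mul (emb F σ₁ b),
      ofReal_mul_cpow ha₁ ha2, ofReal_mul_cpow hb₁ hb2]
    linear_combination congrArg₂ (· * ·) f1 f2
  · rw [if_neg h, if_neg (fun h' => h (hc.mp h')), mul_zero]

/-- The index set of classes of nonzero rows modulo totally positive units. -/
abbrev RowQuot (σ₁ σ₂ : F →+* ℝ) := Quot (RowRel F σ₁ σ₂)

lemma rowQuot_mk_eq_iff {σ₁ σ₂ : F →+* ℝ}
    {v v' : {v : Fin 2 → NumberField.RingOfIntegers F // v ≠ 0}} :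
    (Quot.mk _ v : RowQuot F σ₁ σ₂) = Quot.mk _ v' ↔ RowRel F σ₁ σ₂ v v' :=
  (rowRel_equivalence F σ₁ σ₂).quot_mk_eq_iff v v'

lemma rowRel_out {σ₁ σ₂ : F →+* ℝ} (v : {v : Fin 2 → NumberField.RingOfIntegers F // v ≠ 0}) :
    RowRel F σ₁ σ₂ v (Quot.out (Quot.mk (RowRel F σ₁ σ₂) v)) := by
  rw [← rowQuot_mk_eq_iff, Quot.out_eq]

/-- `rowSummand` on pairs of classes of rows. -/
def quotSummand (σ₁ σ₂ : F →+* ℝ) (k : ℕ) (s w z₁ z₂ : ℂ)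
    (p : RowQuot F σ₁ σ₂ × RowQuot F σ₁ σ₂) : ℂ :=
  rowSummand F σ₁ σ₂ k s w z₁ z₂ p.1.out.1 p.2.out.1

lemma quotSummand_mk {σ₁ σ₂ : F →+* ℝ} (hF : RealQuadNarrowOne F σ₁ σ₂) (k : ℕ) (s w : ℂ)
    {z₁ z₂ : ℂ} (hz₁ : 0 < z₁.im) (hz₂ : 0 < z₂.im)
    (x y : {v : Fin 2 → NumberField.RingOfIntegers F // v ≠ 0}) :
    quotSummand F σ₁ σ₂ k s w z₁ z₂ (Quot.mk _ x, Quot.mk _ y) =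
      rowSummand F σ₁ σ₂ k s w z₁ z₂ x.1 y.1 := by
  obtain ⟨ε, h1, h2, h⟩ := rowRel_out F (σ₁ := σ₁) (σ₂ := σ₂) x
  obtain ⟨ε', h1', h2', h'⟩ := rowRel_out F (σ₁ := σ₁) (σ₂ := σ₂) y
  unfold quotSummand
  rw [h, h', rowSummand_smul F σ₁ σ₂ k s w hz₁ hz₂ h1 h2 h1' h2',
    emb_mul_unit_eq_one F hF h1 h2, emb_mul_unit_eq_one F hF h1' h2']
  simp

/-- The archimedean sup norm of a row at one real place. -/
def rowHeight (σ : F →+* ℝ) (v : Fin 2 → NumberField.RingOfIntegers F) : ℝ :=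
  max |emb F σ (v 0)| |emb F σ (v 1)|

lemma rowHeight_pos (σ : F →+* ℝ) {v : Fin 2 → NumberField.RingOfIntegers F} (hv : v ≠ 0) :
    0 < rowHeight F σ v := by
  by_contra! h
  apply hv
  have h0 := (le_max_left _ _).trans h
  have h1 := (le_max_right _ _).trans h
  ext i
  fin_cases i
  · simpa [map_eq_zero_iff _ (emb_injective F σ)] using h0
  · simpa [map_eq_zero_iff _ (emb_injective F σ)] using h1

lemma rowHeight_smul (σ : F →+* ℝ) (a : NumberField.RingOfIntegers F)
    (v : Fin 2 → NumberField.RingOfIntegers F) :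
    rowHeight F σ (a • v) = |emb F σ a| * rowHeight F σ v := by
  simp only [rowHeight, Pi.smul_apply, smul_eq_mul, map_mul, abs_mul]
  rw [mul_max_of_nonneg _ _ (abs_nonneg _)]

lemma exists_rowHeight_le (σ : F →+* ℝ) {z : ℂ} (hz : 0 < z.im) :
    ∃ C : ℝ, 0 < C ∧ ∀ v, rowHeight F σ v ≤ C * ‖lin F σ v z‖ := by
  refine ⟨1 / z.im + (1 + ‖z‖ / z.im), by positivity, fun v => ?_⟩
  set a := emb F σ (v 0)
  set b := emb F σ (v 1)
  have hl : lin F σ v z = (a : ℂ) * z + (b : ℂ) := rfl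
  have h1 : |a| * z.im ≤ ‖lin F σ v z‖ := by
    have := Complex.abs_im_le_norm (lin F σ v z)
    rw [hl] at this ⊢
    simpa [abs_mul, abs_of_pos hz] using this
  have h1' : |a| ≤ ‖lin F σ v z‖ / z.im := (le_div_iff₀ hz).mpr h1
  have h2 : |b| ≤ ‖lin F σ v z‖ + |a| * ‖z‖ := by
    have e : (b : ℂ) = lin F σ v z - (a : ℂ) * z := by rw [hl]; ring
    have := norm_sub_le (lin F σ v z) ((a : ℂ) * z)
    rw [← e] at this
    simpa using this
  have h3 : |b| ≤ (1 + ‖z‖ / z.im) * ‖lin F σ v z‖ := by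
    calc |b| ≤ ‖lin F σ v z‖ + ‖lin F σ v z‖ / z.im * ‖z‖ := by
          refine h2.trans ?_; gcongr
      _ = _ := by ring
  have hn := norm_nonneg (lin F σ v z)
  have p1 : 0 ≤ 1 / z.im * ‖lin F σ v z‖ := by positivity
  have p2 : 0 ≤ (1 + ‖z‖ / z.im) * ‖lin F σ v z‖ := by positivity
  rw [add_mul]
  refine max_le ?_ ?_
  · rw [div_eq_inv_mul, ← one_div] at h1'
    linarith
  · linarith

/-- The embedding of the lattice of rows into Euclidean space of dimension four. -/
def rowEmbed (σ₁ σ₂ : F →+* ℝ) :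
    (Fin 2 → NumberField.RingOfIntegers F) →ₗ[ℤ] (ℝ × ℝ) × (ℝ × ℝ) :=
  (AddMonoidHom.mk' (fun v => ((emb F σ₁ (v 0), emb F σ₁ (v 1)),
    (emb F σ₂ (v 0), emb F σ₂ (v 1)))) (fun x y => by simp)).toIntLinearMap

lemma norm_rowEmbed (σ₁ σ₂ : F →+* ℝ) (v : Fin 2 → NumberField.RingOfIntegers F) :
    ‖rowEmbed F σ₁ σ₂ v‖ = max (rowHeight F σ₁ v) (rowHeight F σ₂ v) := rfl

lemma rowEmbed_injective (σ₁ σ₂ : F →+* ℝ) : Function.Injective (rowEmbed F σ₁ σ₂) := by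
  intro v v' h
  have h0 : emb F σ₁ (v 0) = emb F σ₁ (v' 0) := congrArg (fun p => p.1.1) h
  have h1 : emb F σ₁ (v 1) = emb F σ₁ (v' 1) := congrArg (fun p => p.1.2) h
  ext i
  fin_cases i
  · exact congrArg _ (emb_injective F σ₁ h0)
  · exact congrArg _ (emb_injective F σ₁ h1)

lemma one_le_norm_rowEmbed {σ₁ σ₂ : F →+* ℝ} (hF : RealQuadNarrowOne F σ₁ σ₂)
    {v : Fin 2 → NumberField.RingOfIntegers F} (hv : v ≠ 0) : 1 ≤ ‖rowEmbed F σ₁ σ₂ v‖ := by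
  obtain ⟨i, hi⟩ := Function.ne_iff.mp hv
  have h := one_le_abs_emb_mul F hF.1 hF.2.1 hi
  have b1 : |emb F σ₁ (v i)| ≤ ‖rowEmbed F σ₁ σ₂ v‖ := by
    rw [norm_rowEmbed]
    refine le_trans ?_ (le_max_left _ _)
    fin_cases i
    · exact le_max_left _ _
    · exact le_max_right _ _
  have b2 : |emb F σ₂ (v i)| ≤ ‖rowEmbed F σ₁ σ₂ v‖ := by
    rw [norm_rowEmbed]
    refine le_trans ?_ (le_max_right _ _)
    fin_cases i
    · exact le_max_left _ _
    · exact le_max_right _ _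
  rw [abs_mul] at h
  by_contra! hlt
  have := mul_lt_one_of_nonneg_of_lt_one_left (abs_nonneg _) (b1.trans_lt hlt) (b2.trans hlt.le)
  linarith

lemma summable_norm_rowEmbed {σ₁ σ₂ : F →+* ℝ} (hF : RealQuadNarrowOne F σ₁ σ₂) {t : ℝ}
    (ht : 4 < t) : Summable fun v => ‖rowEmbed F σ₁ σ₂ v‖ ^ (-t) := by
  let L := LinearMap.range (rowEmbed F σ₁ σ₂)
  have : DiscreteTopology L := by
    refine DiscreteTopology.of_forall_le_norm (r := 1) one_pos ?_
    rintro ⟨_, v, rfl⟩ hx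
    refine one_le_norm_rowEmbed F hF ?_
    rintro rfl
    exact hx (by ext1; simp)
  have hrank : Module.finrank ℤ L = 4 := by
    rw [← (LinearEquiv.ofInjective _ (rowEmbed_injective F σ₁ σ₂)).finrank_eq,
      Module.finrank_pi_fintype]
    simp [NumberField.RingOfIntegers.rank, hF.1]
  have h := ZLattice.summable_norm_rpow L (-t) (by rw [hrank]; push_cast; linarith)
  have hinj : Function.Injective fun v => (⟨rowEmbed F σ₁ σ₂ v, v, rfl⟩ : L) :=
    fun v v' hv => rowEmbed_injective F σ₁ σ₂ (congrArg Subtype.val hv)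
  refine (h.comp_injective hinj).congr fun v => ?_
  simp only [Function.comp_apply, Submodule.coe_norm]

lemma exists_balanced {σ₁ σ₂ : F →+* ℝ} (hF : RealQuadNarrowOne F σ₁ σ₂) :
    ∃ B : ℝ, 0 < B ∧ ∀ v : {v : Fin 2 → NumberField.RingOfIntegers F // v ≠ 0},
      ∃ v', RowRel F σ₁ σ₂ v v' ∧ rowHeight F σ₂ v'.1 ≤ rowHeight F σ₁ v'.1 ∧
        rowHeight F σ₁ v'.1 ≤ B * rowHeight F σ₂ v'.1 := by
  obtain ⟨ε, h1, h2⟩ := exists_totPos_unit_gt_one F hF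
  set e := emb F σ₁ (ε : NumberField.RingOfIntegers F) with he
  have he0 : 0 < e := one_pos.trans h1
  have hprod := emb_mul_unit_eq_one F hF he0 h2
  have he2 : emb F σ₂ (ε : NumberField.RingOfIntegers F) = e⁻¹ := by
    rw [← he] at hprod
    exact eq_inv_of_mul_eq_one_right hprod
  refine ⟨e ^ 2, by positivity, fun v => ?_⟩
  have p1 := rowHeight_pos F σ₁ v.2
  have p2 := rowHeight_pos F σ₂ v.2
  obtain ⟨n, hn1, hn2⟩ := exists_mem_Ico_zpow (div_pos p1 p2) (one_lt_pow₀ h1 two_ne_zero)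
  have hz : ∀ (σ : F →+* ℝ) (m : ℤ),
      emb F σ ((ε ^ m : (NumberField.RingOfIntegers F)ˣ) : NumberField.RingOfIntegers F) =
        emb F σ (ε : NumberField.RingOfIntegers F) ^ m := by
    intro σ m
    have h : ((Units.map (emb F σ : NumberField.RingOfIntegers F →* ℝ) (ε ^ m) : ℝˣ) : ℝ) =
        ((Units.map (emb F σ : NumberField.RingOfIntegers F →* ℝ) ε ^ m : ℝˣ) : ℝ) := by
      rw [map_zpow]
    rwa [Units.val_zpow_eq_zpow_val] at h
  have hu1 : emb F σ₁ ((ε ^ (-n) : (NumberField.RingOfIntegers F)ˣ) :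
      NumberField.RingOfIntegers F) = (e ^ n)⁻¹ := by
    rw [hz, ← he, zpow_neg]
  have hu2 : emb F σ₂ ((ε ^ (-n) : (NumberField.RingOfIntegers F)ˣ) :
      NumberField.RingOfIntegers F) = e ^ n := by
    rw [hz, he2, inv_zpow, zpow_neg, inv_inv]
  have hen : 0 < e ^ n := zpow_pos he0 n
  have hv' : (((ε ^ (-n) : (NumberField.RingOfIntegers F)ˣ) : NumberField.RingOfIntegers F) •
      v.1) ≠ 0 := by
    intro h
    apply v.2
    have := congrArg (fun x => ((ε ^ n : (NumberField.RingOfIntegers F)ˣ) :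
      NumberField.RingOfIntegers F) • x) h
    simpa [smul_smul, ← Units.val_mul] using this
  refine ⟨⟨_, hv'⟩, ⟨ε ^ (-n), by rw [hu1]; positivity, by rw [hu2]; positivity, rfl⟩, ?_, ?_⟩
  · simp only [rowHeight_smul, hu1, hu2]
    rw [abs_of_pos hen, abs_of_pos (inv_pos.mpr hen), ← div_eq_inv_mul, le_div_iff₀ hen]
    rw [le_div_iff₀ p2, ← zpow_natCast, ← zpow_mul, mul_comm _ n, zpow_mul, mul_comm] at hn1
    calc e ^ n * rowHeight F σ₂ v.1 * e ^ n = rowHeight F σ₂ v.1 * (e ^ n) ^ ((2 : ℕ) : ℤ) := by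
          rw [zpow_natCast]; ring
      _ ≤ _ := hn1
  · simp only [rowHeight_smul, hu1, hu2]
    rw [abs_of_pos hen, abs_of_pos (inv_pos.mpr hen), ← div_eq_inv_mul, div_le_iff₀ hen]
    rw [div_lt_iff₀ p2, zpow_add_one₀ (by positivity), ← zpow_natCast, ← zpow_mul,
      mul_comm _ n, zpow_mul, zpow_natCast, zpow_natCast] at hn2
    calc rowHeight F σ₁ v.1 ≤ (e ^ n) ^ 2 * e ^ 2 * rowHeight F σ₂ v.1 := hn2.le
      _ = _ := by ring

/-- The summand of the real-analytic Hilbert Eisenstein series. -/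
def rowWeight (σ₁ σ₂ : F →+* ℝ) (z₁ z₂ : ℂ) (t : ℝ)
    (v : Fin 2 → NumberField.RingOfIntegers F) : ℝ :=
  (‖lin F σ₁ v z₁‖ * ‖lin F σ₂ v z₂‖) ^ (-t)

lemma rowWeight_eq_of_rel {σ₁ σ₂ : F →+* ℝ} (hF : RealQuadNarrowOne F σ₁ σ₂) (z₁ z₂ : ℂ) (t : ℝ)
    {v v' : {v : Fin 2 → NumberField.RingOfIntegers F // v ≠ 0}} (h : RowRel F σ₁ σ₂ v v') :
    rowWeight F σ₁ σ₂ z₁ z₂ t v'.1 = rowWeight F σ₁ σ₂ z₁ z₂ t v.1 := by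
  obtain ⟨ε, h1, h2, h⟩ := h
  unfold rowWeight
  rw [h, lin_smul, lin_smul, norm_mul, norm_mul, mul_mul_mul_comm, ← norm_mul,
    ← Complex.ofReal_mul, emb_mul_unit_eq_one F hF h1 h2]
  simp

lemma summable_rowWeight {σ₁ σ₂ : F →+* ℝ} (hF : RealQuadNarrowOne F σ₁ σ₂) {z₁ z₂ : ℂ}
    (hz₁ : 0 < z₁.im) (hz₂ : 0 < z₂.im) {t : ℝ} (ht : 2 < t) :
    Summable fun q : RowQuot F σ₁ σ₂ => rowWeight F σ₁ σ₂ z₁ z₂ t q.out.1 := by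
  obtain ⟨B, hB, hbal⟩ := exists_balanced F hF
  obtain ⟨C₁, hC₁, hh₁⟩ := exists_rowHeight_le F σ₁ hz₁
  obtain ⟨C₂, hC₂, hh₂⟩ := exists_rowHeight_le F σ₂ hz₂
  choose r hr using fun q : RowQuot F σ₁ σ₂ => hbal q.out
  have hinj : Function.Injective fun q => (r q).1 := by
    intro q q' h
    have h' : r q = r q' := Subtype.ext h
    rw [← Quot.out_eq q, ← Quot.out_eq q', (rowQuot_mk_eq_iff F).mpr (hr q).1, h',
      ← (rowQuot_mk_eq_iff F).mpr (hr q').1]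
  have hS := ((summable_norm_rowEmbed F hF (t := 2 * t) (by linarith)).comp_injective
    hinj).mul_left ((1 / (B * C₁ * C₂)) ^ (-t))
  refine Summable.of_nonneg_of_le (fun q => Real.rpow_nonneg (by positivity) _) (fun q => ?_) hS
  obtain ⟨hrel, hle1, hle2⟩ := hr q
  rw [← rowWeight_eq_of_rel F hF z₁ z₂ t hrel]
  set v := (r q).1
  have p1 := rowHeight_pos F σ₁ (r q).2
  have p2 := rowHeight_pos F σ₂ (r q).2
  simp only [Function.comp_apply]
  rw [norm_rowEmbed, max_eq_left hle1, show -(2 * t) = 2 * (-t) by ring, Real.rpow_mul p1.le,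
    ← Real.mul_rpow (by positivity) (by positivity)]
  unfold rowWeight
  refine Real.rpow_le_rpow_of_nonpos (by positivity) ?_ (by linarith)
  rw [Real.rpow_two, div_mul_eq_mul_div, one_mul, div_le_iff₀ (by positivity)]
  calc rowHeight F σ₁ v ^ 2 ≤ rowHeight F σ₁ v * (B * rowHeight F σ₂ v) := by
        rw [sq]; gcongr
    _ ≤ (C₁ * ‖lin F σ₁ v z₁‖) * (B * (C₂ * ‖lin F σ₂ v z₂‖)) := by
        gcongr
        · exact hh₁ v
        · exact hh₂ v
    _ = _ := by ring

lemma norm_cpow_neg_le {q : ℂ} (hq : q ≠ 0) (s : ℂ) :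
    ‖q ^ (-s)‖ ≤ ‖q‖ ^ (-s.re) * Real.exp (Real.pi * |s.im|) := by
  rw [Complex.norm_cpow_of_ne_zero hq, div_eq_mul_inv, ← Real.exp_neg, Complex.neg_re,
    Complex.neg_im]
  gcongr
  calc -(q.arg * -s.im) ≤ |q.arg * s.im| := by rw [mul_neg, neg_neg]; exact le_abs_self _
    _ = |q.arg| * |s.im| := abs_mul _ _
    _ ≤ _ := by gcongr; exact Complex.abs_arg_le_pi q

lemma emb_rowDet_mul_im_le (σ : F →+* ℝ) (x y : Fin 2 → NumberField.RingOfIntegers F) (z : ℂ) :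
    emb F σ (rowDet F x y) * z.im ≤ ‖lin F σ x z‖ * ‖lin F σ y z‖ := by
  rw [← lin_mul_conj_im]
  calc _ ≤ |_| := le_abs_self _
    _ ≤ _ := Complex.abs_im_le_norm _
    _ = _ := by rw [norm_mul, Complex.norm_conj]

lemma exists_norm_rowSummand_le {σ₁ σ₂ : F →+* ℝ} (hF : RealQuadNarrowOne F σ₁ σ₂) (k : ℕ)
    (s w : ℂ) {z₁ z₂ : ℂ} (hz₁ : 0 < z₁.im) (hz₂ : 0 < z₂.im) {p : ℝ} (hp : 0 ≤ p)
    (hwp : w.re - 1 ≤ p) :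
    ∃ C : ℝ, ∀ x y, x ≠ 0 → y ≠ 0 → ‖rowSummand F σ₁ σ₂ k s w z₁ z₂ x y‖ ≤
      C * (rowWeight F σ₁ σ₂ z₁ z₂ (s.re - p) x *
        rowWeight F σ₁ σ₂ z₁ z₂ (k - s.re - p) y) := by
  refine ⟨(z₁.im * z₂.im) ^ (-p) * (Real.exp (Real.pi * |s.im|) * Real.exp (Real.pi * |s.im|)),
    fun x y hx hy => ?_⟩
  have hj₁ := lin_ne_zero F σ₁ hx hz₁
  have hj₂ := lin_ne_zero F σ₂ hx hz₂
  have hl₁ := lin_ne_zero F σ₁ hy hz₁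
  have hl₂ := lin_ne_zero F σ₂ hy hz₂
  have ej₁ := norm_pos_iff.mpr hj₁
  have ej₂ := norm_pos_iff.mpr hj₂
  have el₁ := norm_pos_iff.mpr hl₁
  have el₂ := norm_pos_iff.mpr hl₂
  have b₁ := emb_rowDet_mul_im_le F σ₁ x y z₁
  have b₂ := emb_rowDet_mul_im_le F σ₂ x y z₂
  unfold rowSummand
  split_ifs with h
  · obtain ⟨d₁, d₂⟩ := h
    have hdet0 : rowDet F x y ≠ 0 := by
      intro h; rw [h, map_zero] at d₁; exact lt_irrefl _ d₁
    have hone := one_le_abs_emb_mul F hF.1 hF.2.1 hdet0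
    rw [abs_of_pos (mul_pos d₁ d₂)] at hone
    have q₁ := norm_cpow_neg_le (div_ne_zero hj₁ hl₁) s
    have q₂ := norm_cpow_neg_le (div_ne_zero hj₂ hl₂) s
    rw [norm_div] at q₁ q₂
    rw [norm_mul, norm_mul, norm_mul, norm_mul, norm_mul,
      Complex.norm_cpow_eq_rpow_re_of_pos d₁, Complex.norm_cpow_eq_rpow_re_of_pos d₂,
      norm_zpow, norm_zpow, ← Real.mul_rpow d₁.le d₂.le, Complex.sub_re, Complex.one_re]
    unfold rowWeight
    set J₁ := ‖lin F σ₁ x z₁‖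
    set J₂ := ‖lin F σ₂ x z₂‖
    set L₁ := ‖lin F σ₁ y z₁‖
    set L₂ := ‖lin F σ₂ y z₂‖
    set X := Real.exp (Real.pi * |s.im|)
    set d := emb F σ₁ (rowDet F x y) * emb F σ₂ (rowDet F x y)
    have hd : d ^ (w.re - 1) ≤ (z₁.im * z₂.im) ^ (-p) * (J₁ * J₂ * (L₁ * L₂)) ^ p := by
      calc d ^ (w.re - 1) ≤ d ^ p := Real.rpow_le_rpow_of_exponent_le hone hwp
        _ ≤ ((z₁.im * z₂.im)⁻¹ * (J₁ * J₂ * (L₁ * L₂))) ^ p := by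
          refine Real.rpow_le_rpow (mul_pos d₁ d₂).le ?_ hp
          rw [← div_eq_inv_mul, le_div_iff₀ (by positivity)]
          calc d * (z₁.im * z₂.im) = (emb F σ₁ (rowDet F x y) * z₁.im) *
                (emb F σ₂ (rowDet F x y) * z₂.im) := by ring
            _ ≤ (J₁ * L₁) * (J₂ * L₂) := by gcongr
            _ = _ := by ring
        _ = _ := by
          rw [Real.mul_rpow (by positivity) (by positivity), Real.inv_rpow (by positivity),
            Real.rpow_neg (by positivity)]
    calc _ ≤ ((z₁.im * z₂.im) ^ (-p) * (J₁ * J₂ * (L₁ * L₂)) ^ p) *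
          (((J₁ / L₁) ^ (-s.re) * X) * ((J₂ / L₂) ^ (-s.re) * X)) *
          (L₁ ^ (-(k : ℤ)) * L₂ ^ (-(k : ℤ))) := by gcongr
      _ = (z₁.im * z₂.im) ^ (-p) * (X * X) * ((J₁ * J₂ * (L₁ * L₂)) ^ p *
          ((J₁ / L₁) * (J₂ / L₂)) ^ (-s.re) * (L₁ * L₂) ^ (-(k : ℝ))) := by
        rw [Real.mul_rpow (x := J₁ / L₁) (by positivity) (by positivity),
          ← mul_zpow, ← Real.rpow_intCast]
        push_cast
        ring
      _ = _ := by
        congr 1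
        rw [div_mul_div_comm, Real.div_rpow (by positivity) (by positivity),
          Real.mul_rpow (x := J₁ * J₂) (by positivity) (by positivity),
          show -(s.re - p) = p + -s.re by ring,
          show -((k : ℝ) - s.re - p) = p + s.re + -(k : ℝ) by ring,
          Real.rpow_add (x := J₁ * J₂) (by positivity),
          Real.rpow_add (x := L₁ * L₂) (by positivity),
          Real.rpow_add (x := L₁ * L₂) (by positivity),
          Real.rpow_neg (x := L₁ * L₂) (by positivity) s.re, div_inv_eq_mul]
        ring
  · rw [norm_zero]
    unfold rowWeight
    positivity

lemma summable_quotSummand {σ₁ σ₂ : F →+* ℝ} (hF : RealQuadNarrowOne F σ₁ σ₂) (k : ℕ)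
    {s w : ℂ} (hs1 : 2 < s.re) (hs2 : s.re < (k : ℝ) - 2)
    (hw : w.re < min (s.re - 1) ((k : ℝ) - 1 - s.re))
    {z₁ z₂ : ℂ} (hz₁ : 0 < z₁.im) (hz₂ : 0 < z₂.im) :
    Summable (quotSummand F σ₁ σ₂ k s w z₁ z₂) := by
  obtain ⟨hw1, hw2⟩ := lt_min_iff.mp hw
  obtain ⟨C, hC⟩ := exists_norm_rowSummand_le F hF k s w hz₁ hz₂ (le_max_right (w.re - 1) 0)
    (le_max_left _ _)
  have t1 : 2 < s.re - max (w.re - 1) 0 := by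
    rcases max_cases (w.re - 1) 0 with h | h <;> linarith
  have t2 : 2 < k - s.re - max (w.re - 1) 0 := by
    rcases max_cases (w.re - 1) 0 with h | h <;> linarith
  refine Summable.of_norm_bounded (((summable_rowWeight F hF hz₁ hz₂ t1).mul_of_nonneg
    (summable_rowWeight F hF hz₁ hz₂ t2) (fun q => ?_) (fun q => ?_)).mul_left C)
    (fun q => hC _ _ q.1.out.2 q.2.out.2)
  · exact Real.rpow_nonneg (by positivity) _
  · exact Real.rpow_nonneg (by positivity) _

/-- A totally positive generator of a nonzero ideal. -/
def gen {σ₁ σ₂ : F →+* ℝ} (hF : RealQuadNarrowOne F σ₁ σ₂)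
    (I : {I : Ideal (NumberField.RingOfIntegers F) // I ≠ ⊥}) : NumberField.RingOfIntegers F :=
  (hF.2.2 I.1 I.2).choose

section Gen

variable {σ₁ σ₂ : F →+* ℝ} (hF : RealQuadNarrowOne F σ₁ σ₂)
  (I : {I : Ideal (NumberField.RingOfIntegers F) // I ≠ ⊥})

lemma emb₁_gen_pos : 0 < emb F σ₁ (gen F hF I) := (hF.2.2 I.1 I.2).choose_spec.1.1

lemma emb₂_gen_pos : 0 < emb F σ₂ (gen F hF I) := (hF.2.2 I.1 I.2).choose_spec.1.2

lemma span_gen : Ideal.span {gen F hF I} = I.1 := (hF.2.2 I.1 I.2).choose_spec.2.symm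

lemma gen_ne_zero : gen F hF I ≠ 0 := by
  intro h
  have := emb₁_gen_pos F hF I
  rw [h, map_zero] at this
  exact lt_irrefl _ this

lemma absNorm_eq_emb_gen :
    (Ideal.absNorm I.1 : ℂ) = ((emb F σ₁ (gen F hF I) * emb F σ₂ (gen F hF I) : ℝ) : ℂ) := by
  have h := absNorm_span_eq F hF.1 hF.2.1 (gen F hF I)
  rw [span_gen, abs_of_pos (mul_pos (emb₁_gen_pos F hF I) (emb₂_gen_pos F hF I))] at h
  exact_mod_cast congrArg ((↑) : ℝ → ℂ) h

end Gen

section Pairs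

variable {σ₁ σ₂ : F →+* ℝ}

lemma det_rows_SL (γ : SL2O F) : γ.1 0 0 * γ.1 1 1 - γ.1 0 1 * γ.1 1 0 = 1 := by
  rw [← Matrix.det_fin_two]; exact γ.2

lemma bottom_ne_zero (γ : SL2O F) : γ.1 1 ≠ 0 := by
  intro h
  have := det_rows_SL F γ
  rw [h] at this
  simp at this

lemma lowc_eq_rowDet (γ δ : SL2O F) : lowc F γ δ = rowDet F (γ.1 1) (δ.1 1) := by
  simp [lowc, rowDet, Matrix.SpecialLinearGroup.coe_inv, Matrix.adjugate_fin_two, Matrix.mul_apply,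
    Fin.sum_univ_two]
  ring

lemma dblExt_eq_rowSummand (k : ℕ) (s w z₁ z₂ : ℂ) (γ δ : SL2O F) :
    dblExt F σ₁ σ₂ k s w z₁ z₂ γ δ = rowSummand F σ₁ σ₂ k s w z₁ z₂ (γ.1 1) (δ.1 1) := by
  unfold dblExt dblSummand rowSummand
  rw [lowc_eq_rowDet]
  by_cases h : 0 < emb F σ₁ (rowDet F (γ.1 1) (δ.1 1)) ∧ 0 < emb F σ₂ (rowDet F (γ.1 1) (δ.1 1))
  · exact (if_pos h).trans (if_pos h).symm
  · exact (if_neg h).trans (if_neg h).symm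

lemma gammaInfRel_iff (γ γ' : SL2O F) :
    GammaInfRel F σ₁ σ₂ γ γ' ↔
      RowRel F σ₁ σ₂ ⟨γ.1 1, bottom_ne_zero F γ⟩ ⟨γ'.1 1, bottom_ne_zero F γ'⟩ := by
  constructor
  · rintro ⟨p, ⟨h0, -, h1⟩, rfl⟩
    have hdet := det_rows_SL F p
    rw [h0, mul_zero, sub_zero] at hdet
    refine ⟨⟨p.1 1 1, p.1 0 0, by rw [mul_comm]; exact hdet, hdet⟩, h1.1, h1.2, ?_⟩
    ext i
    simp [Matrix.mul_apply, Fin.sum_univ_two, h0]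
  · rintro ⟨ε, h1, h2, h⟩
    have e0 : γ'.1 1 0 = ε * γ.1 1 0 := congrFun h 0
    have e1 : γ'.1 1 1 = ε * γ.1 1 1 := congrFun h 1
    have hdet := det_rows_SL F γ
    have p10 : (γ' * γ⁻¹).1 1 0 = 0 := by
      change lowc F γ' γ = 0
      rw [lowc_eq_rowDet, rowDet, e0, e1]; ring
    have p11 : (γ' * γ⁻¹).1 1 1 = ε := by
      have : (γ' * γ⁻¹).1 1 1 = - γ'.1 1 0 * γ.1 0 1 + γ'.1 1 1 * γ.1 0 0 := by
        simp [Matrix.SpecialLinearGroup.coe_inv, Matrix.adjugate_fin_two, Matrix.mul_apply,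
          Fin.sum_univ_two]
      rw [this, e0, e1]
      linear_combination (ε : NumberField.RingOfIntegers F) * hdet
    have hp := det_rows_SL F (γ' * γ⁻¹)
    rw [p10, p11, mul_zero, sub_zero] at hp
    have p00 : (γ' * γ⁻¹).1 0 0 = (ε⁻¹ : (NumberField.RingOfIntegers F)ˣ) :=
      Units.eq_inv_of_mul_eq_one_right hp
    refine ⟨γ' * γ⁻¹, ⟨p10, ?_, ?_⟩, by simp⟩
    · rw [p00]; exact ⟨emb_unit_inv_pos F h1, emb_unit_inv_pos F h2⟩
    · rw [p11]; exact ⟨h1, h2⟩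

lemma gammaInfRel_equivalence : Equivalence (GammaInfRel F σ₁ σ₂) where
  refl _ := (gammaInfRel_iff F _ _).mpr ((rowRel_equivalence F σ₁ σ₂).refl _)
  symm h := (gammaInfRel_iff F _ _).mpr
    ((rowRel_equivalence F σ₁ σ₂).symm ((gammaInfRel_iff F _ _).mp h))
  trans h h' := (gammaInfRel_iff F _ _).mpr ((rowRel_equivalence F σ₁ σ₂).trans
    ((gammaInfRel_iff F _ _).mp h) ((gammaInfRel_iff F _ _).mp h'))

lemma pairRel_equivalence : Equivalence (PairRel F σ₁ σ₂) where
  refl _ := ⟨(gammaInfRel_equivalence F).refl _, (gammaInfRel_equivalence F).refl _⟩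
  symm h := ⟨(gammaInfRel_equivalence F).symm h.1, (gammaInfRel_equivalence F).symm h.2⟩
  trans h h' := ⟨(gammaInfRel_equivalence F).trans h.1 h'.1,
    (gammaInfRel_equivalence F).trans h.2 h'.2⟩

variable (hF : RealQuadNarrowOne F σ₁ σ₂)

/-- The class of the row obtained by scaling the bottom row of `γ` by the generator of `I`. -/
def scaledRow (I : {I : Ideal (NumberField.RingOfIntegers F) // I ≠ ⊥}) (γ : SL2O F) :
    RowQuot F σ₁ σ₂ :=
  Quot.mk _ ⟨gen F hF I • γ.1 1, smul_ne_zero (gen_ne_zero F hF I) (bottom_ne_zero F γ)⟩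

lemma dvd_of_smul_eq {a b : NumberField.RingOfIntegers F} (γ γ' : SL2O F)
    (h : a • γ.1 1 = b • γ'.1 1) : b ∣ a := by
  have h0 : a * γ.1 1 0 = b * γ'.1 1 0 := congrFun h 0
  have h1 : a * γ.1 1 1 = b * γ'.1 1 1 := congrFun h 1
  have hdet := det_rows_SL F γ
  refine ⟨γ.1 0 0 * γ'.1 1 1 - γ.1 0 1 * γ'.1 1 0, ?_⟩
  linear_combination (-a) * hdet + γ.1 0 0 * h1 - γ.1 0 1 * h0

lemma scaledRow_eq {I J : {I : Ideal (NumberField.RingOfIntegers F) // I ≠ ⊥}} {γ δ : SL2O F}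
    (h : scaledRow F hF I γ = scaledRow F hF J δ) : I = J ∧ GammaInfRel F σ₁ σ₂ γ δ := by
  obtain ⟨ε, h1, h2, h⟩ := (rowQuot_mk_eq_iff F).mp h
  simp only [smul_smul] at h
  have hIJ : I = J := by
    ext1
    rw [← span_gen F hF I, ← span_gen F hF J]
    apply Ideal.span_singleton_eq_span_singleton.mpr
    refine associated_of_dvd_dvd ?_ ?_
    · exact (Units.mul_left_dvd.mp (dvd_of_smul_eq F δ γ h))
    · exact (Units.dvd_mul_left.mp (dvd_of_smul_eq F γ δ h.symm))
  subst hIJ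
  refine ⟨rfl, (gammaInfRel_iff F _ _).mpr ⟨ε, h1, h2, ?_⟩⟩
  rw [mul_comm, ← smul_smul] at h
  exact smul_right_injective _ (gen_ne_zero F hF I) h

lemma scaledRow_surjective (q : RowQuot F σ₁ σ₂) :
    ∃ I γ, scaledRow F hF I γ = q := by
  induction q using Quot.ind with | _ v => ?_
  obtain ⟨v, hv⟩ := v
  have hI : Ideal.span {v 0, v 1} ≠ ⊥ := by
    intro h
    apply hv
    have h0 : v 0 ∈ Ideal.span {v 0, v 1} := Ideal.subset_span (by simp)
    have h1 : v 1 ∈ Ideal.span {v 0, v 1} := Ideal.subset_span (by simp)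
    rw [h, Ideal.mem_bot] at h0 h1
    ext i
    fin_cases i
    · simp [h0]
    · simp [h1]
  let I : {I : Ideal (NumberField.RingOfIntegers F) // I ≠ ⊥} := ⟨_, hI⟩
  have hs : Ideal.span {gen F hF I} = Ideal.span {v 0, v 1} := span_gen F hF I
  have h0 : v 0 ∈ Ideal.span {gen F hF I} := hs ▸ Ideal.subset_span (by simp)
  have h1 : v 1 ∈ Ideal.span {gen F hF I} := hs ▸ Ideal.subset_span (by simp)
  have ha : gen F hF I ∈ Ideal.span {v 0, v 1} := hs ▸ Ideal.subset_span (by simp)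
  obtain ⟨c, hc⟩ := Ideal.mem_span_singleton.mp h0
  obtain ⟨d, hd⟩ := Ideal.mem_span_singleton.mp h1
  obtain ⟨α, β, hαβ⟩ := Ideal.mem_span_pair.mp ha
  have hcop : IsCoprime c d := by
    refine ⟨α, β, mul_left_cancel₀ (gen_ne_zero F hF I) ?_⟩
    linear_combination hαβ - α * hc - β * hd
  obtain ⟨γ, hγ0, hγ1⟩ := hcop.exists_SL2_row 1
  refine ⟨I, γ, ?_⟩
  unfold scaledRow
  congr 2
  ext i
  fin_cases i
  · simp [hc, ← hγ0]
  · simp [hd, ← hγ1]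

/-- The parametrisation of pairs of rows by pairs of ideals and pairs of cosets. -/
def pairMap (x : ({I : Ideal (NumberField.RingOfIntegers F) // I ≠ ⊥} ×
      {I : Ideal (NumberField.RingOfIntegers F) // I ≠ ⊥}) × Quot (PairRel F σ₁ σ₂)) :
    RowQuot F σ₁ σ₂ × RowQuot F σ₁ σ₂ :=
  (scaledRow F hF x.1.1 x.2.out.1, scaledRow F hF x.1.2 x.2.out.2)

lemma pairMap_bijective : Function.Bijective (pairMap F hF) := by
  constructor
  · rintro ⟨⟨I, J⟩, p⟩ ⟨⟨I', J'⟩, p'⟩ h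
    obtain ⟨hI, hγ⟩ := scaledRow_eq F hF (congrArg Prod.fst h)
    obtain ⟨hJ, hδ⟩ := scaledRow_eq F hF (congrArg Prod.snd h)
    have hp : p = p' := by
      rw [← Quot.out_eq p, ← Quot.out_eq p']
      exact Quot.sound ⟨hγ, hδ⟩
    exact Prod.ext (Prod.ext hI hJ) hp
  · rintro ⟨q, q'⟩
    obtain ⟨I, γ, rfl⟩ := scaledRow_surjective F hF q
    obtain ⟨J, δ, rfl⟩ := scaledRow_surjective F hF q'
    refine ⟨((I, J), Quot.mk _ (γ, δ)), ?_⟩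
    obtain ⟨h1, h2⟩ := ((pairRel_equivalence F (σ₁ := σ₁) (σ₂ := σ₂)).quot_mk_eq_iff _ _).mp
      (Quot.out_eq (Quot.mk (PairRel F σ₁ σ₂) (γ, δ))).symm
    have key : ∀ (I : {I : Ideal (NumberField.RingOfIntegers F) // I ≠ ⊥}) {γ γ' : SL2O F},
        GammaInfRel F σ₁ σ₂ γ γ' → scaledRow F hF I γ' = scaledRow F hF I γ := by
      intro I γ γ' h
      obtain ⟨ε, e1, e2, h⟩ := (gammaInfRel_iff F _ _).mp h
      symm
      refine Quot.sound ⟨ε, e1, e2, ?_⟩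
      simp only at h ⊢
      rw [h, smul_smul, smul_smul, mul_comm]
    exact Prod.ext (key I h1) (key J h2)

lemma quotSummand_pairMap (k : ℕ) (s w : ℂ) {z₁ z₂ : ℂ} (hz₁ : 0 < z₁.im) (hz₂ : 0 < z₂.im)
    {E : Quot (PairRel F σ₁ σ₂) → ℂ}
    (hE : ∀ p : SL2O F × SL2O F, E (Quot.mk _ p) = dblExt F σ₁ σ₂ k s w z₁ z₂ p.1 p.2)
    (I J : {I : Ideal (NumberField.RingOfIntegers F) // I ≠ ⊥}) (q : Quot (PairRel F σ₁ σ₂)) :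
    quotSummand F σ₁ σ₂ k s w z₁ z₂ (pairMap F hF ((I, J), q)) =
      (Ideal.absNorm I.1 : ℂ) ^ (-(1 - w + s)) * (Ideal.absNorm J.1 : ℂ) ^ (-(1 - w + k - s)) *
        E q := by
  unfold pairMap scaledRow
  rw [quotSummand_mk F hF k s w hz₁ hz₂, rowSummand_smul F σ₁ σ₂ k s w hz₁ hz₂
    (emb₁_gen_pos F hF I) (emb₂_gen_pos F hF I) (emb₁_gen_pos F hF J) (emb₂_gen_pos F hF J),
    ← absNorm_eq_emb_gen, ← absNorm_eq_emb_gen, ← dblExt_eq_rowSummand, ← hE q.out,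
    Quot.out_eq]
  ring_nf

lemma summable_norm_absNorm_cpow (hF : RealQuadNarrowOne F σ₁ σ₂) {u : ℂ} (hu : 2 < u.re) :
    Summable fun I : {I : Ideal (NumberField.RingOfIntegers F) // I ≠ ⊥} =>
      ‖(Ideal.absNorm I.1 : ℂ) ^ (-u)‖ := by
  have hI : (0 : ℝ) < Complex.I.im := by simp
  have hinj : Function.Injective fun I => scaledRow F hF I 1 :=
    fun I J h => (scaledRow_eq F hF h).1
  refine ((summable_rowWeight F hF hI hI hu).comp_injective hinj).congr fun I => ?_
  simp only [Function.comp_apply, scaledRow]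
  rw [rowWeight_eq_of_rel F hF _ _ _ (rowRel_out F _)]
  have hpos := mul_pos (emb₁_gen_pos F hF I) (emb₂_gen_pos F hF I)
  rw [absNorm_eq_emb_gen F hF, Complex.norm_cpow_eq_rpow_re_of_pos hpos, rowWeight, lin_smul,
    lin_smul]
  have hl : ∀ σ : F →+* ℝ, lin F σ ((1 : SL2O F).1 1) Complex.I = 1 := by
    intro σ; simp [lin]
  rw [hl, hl, mul_one, mul_one, ← norm_mul, ← Complex.ofReal_mul, Complex.norm_real,
    Real.norm_of_nonneg hpos.le, Complex.neg_re]

lemma summable_and_zeta_mul (hF : RealQuadNarrowOne F σ₁ σ₂) (k : ℕ) {s w : ℂ}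
    (hs1 : 2 < s.re) (hs2 : s.re < (k : ℝ) - 2)
    (hw : w.re < min (s.re - 1) ((k : ℝ) - 1 - s.re))
    {z₁ z₂ : ℂ} (hz₁ : 0 < z₁.im) (hz₂ : 0 < z₂.im)
    {E : Quot (PairRel F σ₁ σ₂) → ℂ}
    (hE : ∀ p : SL2O F × SL2O F, E (Quot.mk _ p) = dblExt F σ₁ σ₂ k s w z₁ z₂ p.1 p.2) :
    Summable E ∧ zetaVal F (1 - w + s) * zetaVal F (1 - w + (k : ℂ) - s) * ∑' q, E q =
      ∑' p, quotSummand F σ₁ σ₂ k s w z₁ z₂ p := by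
  have hS := (summable_quotSummand F hF k hs1 hs2 hw hz₁ hz₂).comp_injective
    (pairMap_bijective F hF).injective
  have hsE : Summable E := by
    let I₁ : {I : Ideal (NumberField.RingOfIntegers F) // I ≠ ⊥} := ⟨⊤, top_ne_bot⟩
    have hinj : Function.Injective fun q : Quot (PairRel F σ₁ σ₂) => ((I₁, I₁), q) :=
      fun q q' h => congrArg Prod.snd h
    refine (hS.comp_injective hinj).congr fun q => ?_
    simp only [Function.comp_apply]
    rw [quotSummand_pairMap F hF k s w hz₁ hz₂ hE]
    simp [I₁]
  obtain ⟨hw1, hw2⟩ := lt_min_iff.mp hw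
  have hZ1 := summable_norm_absNorm_cpow F hF (u := 1 - w + s) (by simp; linarith)
  have hZ2 := summable_norm_absNorm_cpow F hF (u := 1 - w + (k : ℂ) - s) (by simp; linarith)
  refine ⟨hsE, ?_⟩
  unfold zetaVal
  rw [tsum_mul_tsum_of_summable_norm hZ1 hZ2,
    tsum_mul_tsum_of_summable_norm (summable_mul_of_summable_norm hZ1 hZ2).norm hsE.norm,
    ← (pairMap_bijective F hF).injective.tsum_eq
      (by rw [(pairMap_bijective F hF).surjective.range_eq]; exact Set.subset_univ _)]
  refine tsum_congr fun x => ?_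
  exact (quotSummand_pairMap F hF k s w hz₁ hz₂ hE _ _ _).symm

end Pairs

section Hecke

variable {σ₁ σ₂ : F →+* ℝ}

lemma lin_mul_row (σ : F →+* ℝ) (g m : Matrix (Fin 2) (Fin 2) (NumberField.RingOfIntegers F))
    (i : Fin 2) {z : ℂ} (h : lin F σ (m 1) z ≠ 0) :
    lin F σ ((g * m) i) z =
      lin F σ (g i) (moebius (m.map (emb F σ)) z) * jfac (m.map (emb F σ)) z := by
  change _ = (_ * (lin F σ (m 0) z / lin F σ (m 1) z) + _) * lin F σ (m 1) z
  rw [add_mul, mul_assoc, div_mul_cancel₀ _ h]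
  simp only [lin, Matrix.mul_apply, Fin.sum_univ_two, map_add, map_mul, Complex.ofReal_add,
    Complex.ofReal_mul]
  ring

lemma row_ne_zero {M : Matrix (Fin 2) (Fin 2) (NumberField.RingOfIntegers F)} (h : M.det ≠ 0)
    (i : Fin 2) : M i ≠ 0 :=
  fun hi => h (Matrix.det_eq_zero_of_row_eq_zero i fun j => congrFun hi j)

/-- The classes of the two rows of a matrix with nonzero determinant. -/
def rowPair {M : Matrix (Fin 2) (Fin 2) (NumberField.RingOfIntegers F)} (h : M.det ≠ 0) :
    RowQuot F σ₁ σ₂ × RowQuot F σ₁ σ₂ :=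
  (Quot.mk _ ⟨M 0, row_ne_zero F h 0⟩, Quot.mk _ ⟨M 1, row_ne_zero F h 1⟩)

lemma diag_mul (a b : NumberField.RingOfIntegers F)
    (M : Matrix (Fin 2) (Fin 2) (NumberField.RingOfIntegers F)) :
    !![a, 0; 0, b] * M = ![a • M 0, b • M 1] := by
  ext i j
  fin_cases i <;> simp [Matrix.mul_apply, Fin.sum_univ_two]

lemma rowPair_eq_iff {M M' : Matrix (Fin 2) (Fin 2) (NumberField.RingOfIntegers F)}
    (h : M.det ≠ 0) (h' : M'.det ≠ 0) :
    (rowPair F h : RowQuot F σ₁ σ₂ × RowQuot F σ₁ σ₂) = rowPair F h' ↔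
      ∃ ε₁ ε₂ : (NumberField.RingOfIntegers F)ˣ,
        (0 < emb F σ₁ (ε₁ : NumberField.RingOfIntegers F) ∧
          0 < emb F σ₂ (ε₁ : NumberField.RingOfIntegers F)) ∧
        (0 < emb F σ₁ (ε₂ : NumberField.RingOfIntegers F) ∧
          0 < emb F σ₂ (ε₂ : NumberField.RingOfIntegers F)) ∧
        M' = !![(ε₁ : NumberField.RingOfIntegers F), 0; 0, (ε₂ : NumberField.RingOfIntegers F)] * M
        := by
  simp only [rowPair, Prod.mk.injEq, rowQuot_mk_eq_iff, diag_mul]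
  constructor
  · rintro ⟨⟨ε₁, p1, p2, e⟩, ⟨ε₂, p1', p2', e'⟩⟩
    refine ⟨ε₁, ε₂, ⟨p1, p2⟩, ⟨p1', p2'⟩, ?_⟩
    ext i j
    fin_cases i
    · exact congrArg _ (congrFun e j)
    · exact congrArg _ (congrFun e' j)
  · rintro ⟨ε₁, ε₂, ⟨p1, p2⟩, ⟨p1', p2'⟩, e⟩
    exact ⟨⟨ε₁, p1, p2, congrFun e 0⟩, ⟨ε₂, p1', p2', congrFun e 1⟩⟩

/-- The matrix `diag(u, u⁻¹)` in `SL₂(O)`. -/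
def diagSL (u : (NumberField.RingOfIntegers F)ˣ) : SL2O F :=
  ⟨!![(u : NumberField.RingOfIntegers F), 0; 0,
    ((u⁻¹ : (NumberField.RingOfIntegers F)ˣ) : NumberField.RingOfIntegers F)],
    by simp [Matrix.det_fin_two]⟩

lemma diagSL_mul (u v : (NumberField.RingOfIntegers F)ˣ) :
    diagSL F (u * v) = diagSL F u * diagSL F v := by
  apply Subtype.ext
  ext i j
  rw [Matrix.SpecialLinearGroup.coe_mul]
  fin_cases i <;> fin_cases j <;> simp [diagSL, mul_comm]

lemma diagSL_one : diagSL F 1 = 1 := by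
  apply Subtype.ext
  ext i j
  fin_cases i <;> fin_cases j <;> simp [diagSL]

lemma smul_diagSL (u v : (NumberField.RingOfIntegers F)ˣ) :
    (u : NumberField.RingOfIntegers F) • (diagSL F v).1 =
      !![((u * v : (NumberField.RingOfIntegers F)ˣ) : NumberField.RingOfIntegers F), 0;
        0, ((u * v⁻¹ : (NumberField.RingOfIntegers F)ˣ) : NumberField.RingOfIntegers F)] := by
  simp [diagSL]

lemma aRel_iff (γ γ' : SL2O F) :
    ARel F σ₁ σ₂ γ γ' ↔ ∃ ε : (NumberField.RingOfIntegers F)ˣ,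
      (0 < emb F σ₁ (ε : NumberField.RingOfIntegers F) ∧
        0 < emb F σ₂ (ε : NumberField.RingOfIntegers F)) ∧ γ' = diagSL F ε * γ := by
  constructor
  · rintro ⟨a, ⟨ε, h, ha⟩, rfl⟩
    refine ⟨ε, h, ?_⟩
    congr 1
    exact Subtype.ext ha
  · rintro ⟨ε, h, e⟩
    exact ⟨diagSL F ε, ⟨ε, h, rfl⟩, e⟩

lemma aRel_equivalence : Equivalence (ARel F σ₁ σ₂) where
  refl γ := (aRel_iff F _ _).mpr ⟨1, by simp, by rw [diagSL_one, one_mul]⟩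
  symm := by
    simp only [aRel_iff]
    rintro γ _ ⟨ε, h, rfl⟩
    refine ⟨ε⁻¹, ⟨emb_unit_inv_pos F h.1, emb_unit_inv_pos F h.2⟩, ?_⟩
    rw [← mul_assoc, ← diagSL_mul, inv_mul_cancel, diagSL_one, one_mul]
  trans := by
    simp only [aRel_iff]
    rintro γ _ _ ⟨ε, h, rfl⟩ ⟨ε', h', rfl⟩
    refine ⟨ε' * ε, ?_, by rw [← mul_assoc, diagSL_mul]⟩
    simp only [Units.val_mul, map_mul]
    exact ⟨mul_pos h'.1 h.1, mul_pos h'.2 h.2⟩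

lemma mnRel_symm {I : Ideal (NumberField.RingOfIntegers F)} {m m' : Mn F σ₁ σ₂ I}
    (h : MnRel F σ₁ σ₂ I m m') : MnRel F σ₁ σ₂ I m' m := by
  obtain ⟨u, γ, e⟩ := h
  refine ⟨u⁻¹, γ⁻¹, ?_⟩
  rw [e, Matrix.mul_smul, smul_smul, ← Matrix.mul_assoc, ← Matrix.SpecialLinearGroup.coe_mul]
  simp

lemma mnRel_equivalence (I : Ideal (NumberField.RingOfIntegers F)) :
    Equivalence (MnRel F σ₁ σ₂ I) where
  refl m := ⟨1, 1, by simp⟩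
  symm := mnRel_symm F
  trans := by
    rintro m m' m'' ⟨u, γ, e⟩ ⟨u', γ', e'⟩
    refine ⟨u' * u, γ' * γ, ?_⟩
    rw [e', e, Matrix.mul_smul, smul_smul, ← Matrix.mul_assoc, Matrix.SpecialLinearGroup.coe_mul,
      Units.val_mul]

lemma cohenSummand_eq_rowSummand (k : ℕ) (s u₁ u₂ : ℂ) (γ : SL2O F) :
    cohenSummand F σ₁ σ₂ k s u₁ u₂ γ = rowSummand F σ₁ σ₂ k s 1 u₁ u₂ (γ.1 0) (γ.1 1) := by
  have hd : rowDet F (γ.1 0) (γ.1 1) = 1 := det_rows_SL F γ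
  unfold rowSummand
  rw [hd, if_pos (by simp)]
  simp only [map_one, Complex.ofReal_one, Complex.one_cpow, one_mul]
  rfl

lemma cohenSummand_eq_of_aRel (hF : RealQuadNarrowOne F σ₁ σ₂) (k : ℕ) (s : ℂ) {u₁ u₂ : ℂ}
    (hu₁ : 0 < u₁.im) (hu₂ : 0 < u₂.im) {γ γ' : SL2O F} (h : ARel F σ₁ σ₂ γ γ') :
    cohenSummand F σ₁ σ₂ k s u₁ u₂ γ' = cohenSummand F σ₁ σ₂ k s u₁ u₂ γ := by
  obtain ⟨ε, ⟨h1, h2⟩, rfl⟩ := (aRel_iff F _ _).mp h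
  have e := diag_mul F (ε : NumberField.RingOfIntegers F)
    ((ε⁻¹ : (NumberField.RingOfIntegers F)ˣ) : NumberField.RingOfIntegers F) γ.1
  have e0 : (diagSL F ε * γ).1 0 = (ε : NumberField.RingOfIntegers F) • γ.1 0 := congrFun e 0
  have e1 : (diagSL F ε * γ).1 1 =
    ((ε⁻¹ : (NumberField.RingOfIntegers F)ˣ) : NumberField.RingOfIntegers F) • γ.1 1 := congrFun e 1
  have p1 := emb_unit_inv_pos F h1
  have p2 := emb_unit_inv_pos F h2
  rw [cohenSummand_eq_rowSummand, cohenSummand_eq_rowSummand, e0, e1,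
    rowSummand_smul F σ₁ σ₂ k s 1 hu₁ hu₂ h1 h2 p1 p2, emb_mul_unit_eq_one F hF h1 h2,
    emb_mul_unit_eq_one F hF p1 p2]
  simp

/-- The determinant of an element of `M_𝔫` does not vanish. -/
lemma Mn.det_ne_zero {I : Ideal (NumberField.RingOfIntegers F)} (m : Mn F σ₁ σ₂ I) :
    m.1.det ≠ 0 := by
  intro h
  have := m.2.1.1
  rw [h] at this
  simp at this

lemma det_SL_mul (γ : SL2O F) (M : Matrix (Fin 2) (Fin 2) (NumberField.RingOfIntegers F)) :
    (γ.1 * M).det = M.det := by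
  rw [Matrix.det_mul, show γ.1.det = 1 from γ.2, one_mul]

lemma det_SL_mul_ne_zero {I : Ideal (NumberField.RingOfIntegers F)} (γ : SL2O F)
    (m : Mn F σ₁ σ₂ I) : (γ.1 * m.1).det ≠ 0 := by
  rw [det_SL_mul]; exact Mn.det_ne_zero F m

/-- The parametrisation of pairs of rows by an ideal `I`, a coset in `ZΓ\M_I` and a coset in
`A\Γ`. -/
def heckeMap (x : Σ I : {I : Ideal (NumberField.RingOfIntegers F) // I ≠ ⊥},
      Quot (MnRel F σ₁ σ₂ I.1) × Quot (ARel F σ₁ σ₂)) :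
    RowQuot F σ₁ σ₂ × RowQuot F σ₁ σ₂ :=
  rowPair F (det_SL_mul_ne_zero F x.2.2.out x.2.1.out)

lemma matrix_mul_right_cancel {X Y m : Matrix (Fin 2) (Fin 2) (NumberField.RingOfIntegers F)}
    (hm : m.det ≠ 0) (h : X * m = Y * m) : X = Y := by
  have := congrArg (· * m.adjugate) h
  simp only [Matrix.mul_assoc, Matrix.mul_adjugate, Matrix.mul_smul, Matrix.mul_one] at this
  exact smul_right_injective _ hm this

lemma det_diag_mul (a b : NumberField.RingOfIntegers F)
    (M : Matrix (Fin 2) (Fin 2) (NumberField.RingOfIntegers F)) :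
    (!![a, 0; 0, b] * M).det = a * b * M.det := by
  rw [Matrix.det_mul]; simp [Matrix.det_fin_two]

lemma mnRel_of_mul_eq (hF : RealQuadNarrowOne F σ₁ σ₂)
    {I : Ideal (NumberField.RingOfIntegers F)} {m m' : Mn F σ₁ σ₂ I} {γ γ' : SL2O F}
    {ε₁ ε₂ : (NumberField.RingOfIntegers F)ˣ}
    (h₁ : 0 < emb F σ₁ (ε₁ : NumberField.RingOfIntegers F) ∧
      0 < emb F σ₂ (ε₁ : NumberField.RingOfIntegers F))
    (h₂ : 0 < emb F σ₁ (ε₂ : NumberField.RingOfIntegers F) ∧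
      0 < emb F σ₂ (ε₂ : NumberField.RingOfIntegers F))
    (h : γ'.1 * m'.1 =
      !![(ε₁ : NumberField.RingOfIntegers F), 0; 0, (ε₂ : NumberField.RingOfIntegers F)] *
        (γ.1 * m.1)) :
    MnRel F σ₁ σ₂ I m m' := by
  obtain ⟨v, hv⟩ := exists_sq_of_totPos F hF (ε₁ * ε₂)
    (by rw [Units.val_mul, map_mul]; exact mul_pos h₁.1 h₂.1)
    (by rw [Units.val_mul, map_mul]; exact mul_pos h₁.2 h₂.2)
  have hD : ε₂ = v * (v * ε₁⁻¹) := by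
    rw [← mul_assoc, ← sq, ← hv, mul_comm ε₁, mul_inv_cancel_right]
  have hdiag : !![(ε₁ : NumberField.RingOfIntegers F), 0; 0, (ε₂ : NumberField.RingOfIntegers F)] =
      (v : NumberField.RingOfIntegers F) • (diagSL F (ε₁ * v⁻¹)).1 := by
    rw [smul_diagSL, mul_left_comm, mul_inv_cancel, mul_one, mul_inv, inv_inv, hD,
      mul_comm ε₁⁻¹]
  refine ⟨v, γ'⁻¹ * diagSL F (ε₁ * v⁻¹) * γ, ?_⟩
  have e : m'.1 = (γ'⁻¹).1 * (γ'.1 * m'.1) := by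
    rw [← Matrix.mul_assoc]
    change m'.1 = (γ'⁻¹ * γ').1 * m'.1
    rw [inv_mul_cancel]
    exact (Matrix.one_mul _).symm
  rw [e, h, hdiag, Matrix.smul_mul, Matrix.mul_smul, Matrix.SpecialLinearGroup.coe_mul,
    Matrix.SpecialLinearGroup.coe_mul, Matrix.mul_assoc, Matrix.mul_assoc]

lemma heckeMap_injective (hF : RealQuadNarrowOne F σ₁ σ₂) :
    Function.Injective (heckeMap F (σ₁ := σ₁) (σ₂ := σ₂)) := by
  rintro ⟨I, q, η⟩ ⟨I', q', η'⟩ h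
  obtain ⟨ε₁, ε₂, h₁, h₂, e⟩ := (rowPair_eq_iff F _ _).mp h
  simp only at e
  have hdet : q'.out.1.det = ε₁ * ε₂ * q.out.1.det := by
    rw [← det_SL_mul F η'.out, e, det_diag_mul, det_SL_mul]
  obtain rfl : I = I' := by
    ext1
    rw [← q.out.2.2, ← q'.out.2.2, hdet, ← Units.val_mul]
    exact (Ideal.span_singleton_mul_left_unit (Units.isUnit _) _).symm
  obtain rfl : q = q' := by
    rw [← Quot.out_eq q, ← Quot.out_eq q']
    exact Quot.sound (mnRel_of_mul_eq F hF h₁ h₂ e)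
  have hε : ε₁ * ε₂ = 1 := by
    ext1
    apply mul_right_cancel₀ (Mn.det_ne_zero F q.out)
    rw [Units.val_mul, ← hdet, Units.val_one, one_mul]
  obtain rfl : ε₂ = ε₁⁻¹ := (inv_eq_of_mul_eq_one_right hε).symm
  rw [← Matrix.mul_assoc] at e
  obtain rfl : η = η' := by
    rw [← Quot.out_eq η, ← Quot.out_eq η']
    exact Quot.sound ((aRel_iff F _ _).mpr
      ⟨ε₁, h₁, Subtype.ext (matrix_mul_right_cancel F (Mn.det_ne_zero F q.out) e)⟩)
  rfl

lemma rowPair_mem_range_heckeMap {M : Matrix (Fin 2) (Fin 2) (NumberField.RingOfIntegers F)}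
    (h : M.det ≠ 0) (h1 : 0 < emb F σ₁ M.det) (h2 : 0 < emb F σ₂ M.det) :
    rowPair F h ∈ Set.range (heckeMap F (σ₁ := σ₁) (σ₂ := σ₂)) := by
  let I : {I : Ideal (NumberField.RingOfIntegers F) // I ≠ ⊥} :=
    ⟨Ideal.span {M.det}, by simpa using h⟩
  let m : Mn F σ₁ σ₂ I.1 := ⟨M, ⟨h1, h2⟩, rfl⟩
  let q : Quot (MnRel F σ₁ σ₂ I.1) := Quot.mk _ m
  obtain ⟨u, γ, e⟩ := ((mnRel_equivalence F I.1).quot_mk_eq_iff _ _).mp (Quot.out_eq q).symm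
  let η : Quot (ARel F σ₁ σ₂) := Quot.mk _ (diagSL F u * γ⁻¹)
  obtain ⟨ε, hε, e'⟩ := (aRel_iff F _ _).mp
    (((aRel_equivalence F).quot_mk_eq_iff _ _).mp (Quot.out_eq η).symm)
  refine ⟨⟨I, q, η⟩, ((rowPair_eq_iff F h _).mpr ⟨ε * u ^ 2, ε⁻¹, ?_, ?_, ?_⟩).symm⟩
  · have hu : ∀ σ : F →+* ℝ, 0 < emb F σ (u : NumberField.RingOfIntegers F) ^ 2 := fun σ =>
      sq_pos_of_ne_zero ((map_ne_zero_iff _ (emb_injective F σ)).mpr u.ne_zero)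
    simp only [Units.val_mul, Units.val_pow_eq_pow_val, map_mul, map_pow]
    exact ⟨mul_pos hε.1 (hu σ₁), mul_pos hε.2 (hu σ₂)⟩
  · exact ⟨emb_unit_inv_pos F hε.1, emb_unit_inv_pos F hε.2⟩
  · have eγ : (γ⁻¹).1 * (γ.1 * m.1) = m.1 := by
      rw [← Matrix.mul_assoc]
      change (γ⁻¹ * γ).1 * m.1 = m.1
      rw [inv_mul_cancel]
      exact Matrix.one_mul _
    simp only
    rw [e', e, ← mul_assoc, ← diagSL_mul, Matrix.SpecialLinearGroup.coe_mul, Matrix.mul_assoc,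
      Matrix.mul_smul, eγ, Matrix.mul_smul, ← Matrix.smul_mul]
    rw [smul_diagSL, mul_left_comm, ← sq, mul_inv, mul_left_comm, mul_inv_cancel, mul_one]

lemma support_quotSummand_subset (hF : RealQuadNarrowOne F σ₁ σ₂) (k : ℕ) (s w : ℂ)
    {z₁ z₂ : ℂ} (hz₁ : 0 < z₁.im) (hz₂ : 0 < z₂.im) :
    Function.support (quotSummand F σ₁ σ₂ k s w z₁ z₂) ⊆ Set.range (heckeMap F) := by
  rintro ⟨x, y⟩ hxy
  induction x using Quot.ind with | _ x => ?_
  induction y using Quot.ind with | _ y => ?_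
  rw [Function.mem_support, quotSummand_mk F hF k s w hz₁ hz₂, rowSummand] at hxy
  obtain ⟨h1, h2⟩ : 0 < emb F σ₁ (rowDet F x.1 y.1) ∧ 0 < emb F σ₂ (rowDet F x.1 y.1) := by
    by_contra h
    exact hxy (if_neg h)
  have hdet : (Matrix.of ![x.1, y.1]).det = rowDet F x.1 y.1 := Matrix.det_fin_two _
  rw [← hdet] at h1 h2
  have hne : (Matrix.of ![x.1, y.1]).det ≠ 0 := by
    intro h
    rw [h] at h1
    simp at h1
  exact rowPair_mem_range_heckeMap F hne h1 h2

lemma rowSummand_SL_mul (k : ℕ) (hkeven : Even k) (hk : 2 ≤ k) (s w : ℂ) {z₁ z₂ : ℂ}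
    (hz₁ : 0 < z₁.im) (hz₂ : 0 < z₂.im) (hF : RealQuadNarrowOne F σ₁ σ₂)
    {I : Ideal (NumberField.RingOfIntegers F)} (m : Mn F σ₁ σ₂ I) (γ : SL2O F) :
    rowSummand F σ₁ σ₂ k s w z₁ z₂ ((γ.1 * m.1) 0) ((γ.1 * m.1) 1) =
      (Ideal.absNorm I : ℂ) ^ (w - (k : ℂ)) * (Ideal.absNorm I : ℂ) ^ (k / 2 - 1) *
        slashSummand F σ₁ σ₂ k (fun u₁ u₂ => cohenSummand F σ₁ σ₂ k s u₁ u₂ γ) z₁ z₂ m.1 := by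
  have h1 : 0 < emb F σ₁ m.1.det := m.2.1.1
  have h2 : 0 < emb F σ₂ m.1.det := m.2.1.2
  have hN : (Ideal.absNorm I : ℂ) = ((emb F σ₁ m.1.det * emb F σ₂ m.1.det : ℝ) : ℂ) := by
    have := absNorm_span_eq F hF.1 hF.2.1 m.1.det
    rw [m.2.2, abs_of_pos (mul_pos h1 h2)] at this
    exact_mod_cast congrArg (fun r : ℝ => (r : ℂ)) this
  have hN0 : ((emb F σ₁ m.1.det * emb F σ₂ m.1.det : ℝ) : ℂ) ≠ 0 := by
    exact_mod_cast (mul_pos h1 h2).ne'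
  have hd : rowDet F ((γ.1 * m.1) 0) ((γ.1 * m.1) 1) = m.1.det := by
    rw [← det_SL_mul F γ m.1, Matrix.det_fin_two]; rfl
  have hl : ∀ (σ : F →+* ℝ) {z : ℂ}, 0 < z.im → lin F σ (m.1 1) z ≠ 0 := fun σ _ hz =>
    lin_ne_zero F σ (row_ne_zero F (Mn.det_ne_zero F m) 1) hz
  have hj : ∀ (σ : F →+* ℝ) {z : ℂ}, 0 < z.im → jfac (m.1.map (emb F σ)) z ≠ 0 := hl
  have hpow : ((emb F σ₁ m.1.det * emb F σ₂ m.1.det : ℝ) : ℂ) ^ (w - 1) =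
      ((emb F σ₁ m.1.det * emb F σ₂ m.1.det : ℝ) : ℂ) ^ (w - (k : ℂ)) *
      ((emb F σ₁ m.1.det * emb F σ₂ m.1.det : ℝ) : ℂ) ^ (k / 2 - 1) *
      ((emb F σ₁ m.1.det * emb F σ₂ m.1.det : ℝ) : ℂ) ^ (k / 2) := by
    obtain ⟨l, rfl⟩ := hkeven
    rw [← Complex.cpow_natCast, ← Complex.cpow_natCast, ← Complex.cpow_add _ _ hN0,
      ← Complex.cpow_add _ _ hN0, show (l + l) / 2 = l by omega, Nat.cast_sub (by omega)]
    congr 1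
    push_cast
    ring
  unfold rowSummand
  rw [hd, if_pos ⟨h1, h2⟩, hN, lin_mul_row F σ₁ γ.1 m.1 _ (hl σ₁ hz₁),
    lin_mul_row F σ₁ γ.1 m.1 _ (hl σ₁ hz₁), lin_mul_row F σ₂ γ.1 m.1 _ (hl σ₂ hz₂),
    lin_mul_row F σ₂ γ.1 m.1 _ (hl σ₂ hz₂), mul_div_mul_right _ _ (hj σ₁ hz₁),
    mul_div_mul_right _ _ (hj σ₂ hz₂), ← ofReal_mul_cpow h1 (by exact_mod_cast h2.ne'),
    ← Complex.ofReal_mul, hpow, mul_zpow, mul_zpow]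
  unfold slashSummand cohenSummand
  change _ * (_ * _) * ((jfac (mat F σ₁ γ) _ ^ _ * _) * (jfac (mat F σ₂ γ) _ ^ _ * _)) = _
  have hm : ∀ (σ : F →+* ℝ) (u : ℂ), lin F σ (γ.1 0) u / lin F σ (γ.1 1) u =
    moebius (mat F σ γ) u := fun _ _ => rfl
  rw [hm, hm]
  ring

lemma moebius_im_pos (σ : F →+* ℝ)
    {m : Matrix (Fin 2) (Fin 2) (NumberField.RingOfIntegers F)} (hm : 0 < emb F σ m.det) {z : ℂ}
    (hz : 0 < z.im) : 0 < (moebius (m.map (emb F σ)) z).im := by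
  rw [Matrix.det_fin_two] at hm
  exact lin_div_im_pos F σ hz hm

end Hecke

/-- For even `k ≥ 6`, `2 < Re s < k-2`,
`Re w < min (Re s - 1) (k - 1 - Re s)` and `z ∈ ℍ²`:
`ζ_F(1-w+s) ζ_F(1-w+k-s) E_{s,k-s}(z;w)
  = Σ_𝔫 N(𝔫)^{w-k} N(𝔫)^{k/2-1} Σ_{γ ∈ ZΓ\M_𝔫} (K_{k,s}|_k γ)(z)`,
all series converging absolutely; `K_{k,s}` is the Cohen kernel. -/
theorem statement4 (σ₁ σ₂ : F →+* ℝ) (hF : RealQuadNarrowOne F σ₁ σ₂)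
    (k : ℕ) (hkeven : Even k) (hk6 : 6 ≤ k)
    (s w : ℂ) (hs1 : 2 < s.re) (hs2 : s.re < (k : ℝ) - 2)
    (hw : w.re < min (s.re - 1) ((k : ℝ) - 1 - s.re))
    (z₁ z₂ : ℂ) (hz₁ : 0 < z₁.im) (hz₂ : 0 < z₂.im)
    (K : ℂ → ℂ → ℂ)
    (hK : ∀ u₁ u₂ : ℂ, 0 < u₁.im → 0 < u₂.im →
      ∀ f : Quot (ARel F σ₁ σ₂) → ℂ,
        (∀ γ : SL2O F, f (Quot.mk _ γ) = cohenSummand F σ₁ σ₂ k s u₁ u₂ γ) →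
        K u₁ u₂ = ∑' q, f q)
    (E : Quot (PairRel F σ₁ σ₂) → ℂ)
    (hE : ∀ p : SL2O F × SL2O F, E (Quot.mk _ p) = dblExt F σ₁ σ₂ k s w z₁ z₂ p.1 p.2)
    (T : (I : {I : Ideal (NumberField.RingOfIntegers F) // I ≠ ⊥}) →
      Quot (MnRel F σ₁ σ₂ I.1) → ℂ)
    (hT : ∀ (I : {I : Ideal (NumberField.RingOfIntegers F) // I ≠ ⊥})
        (m : Mn F σ₁ σ₂ I.1),
      T I (Quot.mk _ m) = slashSummand F σ₁ σ₂ k K z₁ z₂ m.1) :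
    Summable E ∧ (∀ I, Summable (T I)) ∧
    Summable (fun I : {I : Ideal (NumberField.RingOfIntegers F) // I ≠ ⊥} =>
      (Ideal.absNorm I.1 : ℂ) ^ (w - (k : ℂ)) * (Ideal.absNorm I.1 : ℂ) ^ (k / 2 - 1) *
        ∑' q, T I q) ∧
    zetaVal F (1 - w + s) * zetaVal F (1 - w + (k : ℂ) - s) * ∑' q, E q
      = ∑' I : {I : Ideal (NumberField.RingOfIntegers F) // I ≠ ⊥},
          (Ideal.absNorm I.1 : ℂ) ^ (w - (k : ℂ)) * (Ideal.absNorm I.1 : ℂ) ^ (k / 2 - 1) *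
            ∑' q, T I q := by
  obtain ⟨hsE, hzeta⟩ := summable_and_zeta_mul F hF k hs1 hs2 hw hz₁ hz₂ hE
  set c : {I : Ideal (NumberField.RingOfIntegers F) // I ≠ ⊥} → ℂ := fun I =>
    (Ideal.absNorm I.1 : ℂ) ^ (w - (k : ℂ)) * (Ideal.absNorm I.1 : ℂ) ^ (k / 2 - 1) with hc
  have hc0 : ∀ I, c I ≠ 0 := by
    intro I
    have hN : (Ideal.absNorm I.1 : ℂ) ≠ 0 := by
      rw [Nat.cast_ne_zero]
      exact fun h => I.2 (Ideal.absNorm_eq_zero_iff.mp h)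
    exact mul_ne_zero (fun h => hN (Complex.cpow_eq_zero_iff _ _ |>.mp h).1) (pow_ne_zero _ hN)
  have hG := (summable_quotSummand F hF k hs1 hs2 hw hz₁ hz₂).comp_injective
    (heckeMap_injective F hF)
  have hGapply : ∀ I q η, (quotSummand F σ₁ σ₂ k s w z₁ z₂ ∘ heckeMap F) ⟨I, q, η⟩ =
      c I * slashSummand F σ₁ σ₂ k (fun u₁ u₂ => cohenSummand F σ₁ σ₂ k s u₁ u₂ η.out) z₁ z₂
        q.out.1 := by
    intro I q η
    rw [Function.comp_apply, heckeMap, rowPair, quotSummand_mk F hF k s w hz₁ hz₂]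
    exact rowSummand_SL_mul F k hkeven (by omega) s w hz₁ hz₂ hF q.out η.out
  have hTsum : ∀ I q, ∑' η, (quotSummand F σ₁ σ₂ k s w z₁ z₂ ∘ heckeMap F) ⟨I, q, η⟩ =
      c I * T I q := by
    intro I q
    have hu₁ := moebius_im_pos F σ₁ q.out.2.1.1 hz₁
    have hu₂ := moebius_im_pos F σ₂ q.out.2.1.2 hz₂
    simp only [hGapply]
    rw [tsum_mul_left, ← Quot.out_eq q, hT, Quot.out_eq]
    unfold slashSummand
    rw [tsum_mul_left, hK _ _ hu₁ hu₂ (fun η => cohenSummand F σ₁ σ₂ k s _ _ η.out)]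
    intro γ
    refine (cohenSummand_eq_of_aRel F hF k s hu₁ hu₂ ?_).symm
    rw [← (aRel_equivalence F).quot_mk_eq_iff, Quot.out_eq]
  have hGI := fun I => hG.sigma_factor I
  have hTI : ∀ I, Summable (T I) := by
    intro I
    rw [← summable_mul_left_iff (hc0 I)]
    simp only [← hTsum]
    exact (hGI I).prod
  have hsumI : ∀ I, ∑' x, (quotSummand F σ₁ σ₂ k s w z₁ z₂ ∘ heckeMap F) ⟨I, x⟩ =
      c I * ∑' q, T I q := by
    intro I
    rw [← tsum_mul_left]
    simp only [← hTsum]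
    exact (hGI I).tsum_prod
  refine ⟨hsE, hTI, ?_, ?_⟩
  · exact hG.sigma.congr hsumI
  · rw [hzeta, ← (heckeMap_injective F hF).tsum_eq
      (support_quotSummand_subset F hF k s w hz₁ hz₂)]
    exact hG.tsum_sigma.trans (tsum_congr hsumI)

end HilbertPaper
end
end

section
/- Let s ∈ ℂ with Re(s) > 2 and z = (z₁,z₂) ∈ ℍ². Define f : ℝ² → ℂ by f(x₁,x₂) = (x₁x₂)^{s−1}·exp(2πi(x₁z₁ + x₂z₂)) if x₁ > 0 and x₂ > 0, and f(x₁,x₂) = 0 otherwise. Then f is integrable on ℝ², and for every (w₁,w₂) ∈ ℝ², ∫_{ℝ²} f(x₁,x₂)·exp(2πi(x₁w₁ + x₂w₂)) dx₁dx₂ = (Γ(s)²/(−2πi)^{2s})·(z₁+w₁)^{−s}·(z₂+w₂)^{−s}, with principal branches of the complex powers. -/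
open Complex MeasureTheory

noncomputable section

namespace HilbertPaper

theorem norm_cpow_mul_exp_neg_mul {x : ℝ} (hx : 0 < x) (a r : ℂ) :
    ‖(x : ℂ) ^ a * Complex.exp (-(r * x))‖ = x ^ a.re * Real.exp (-r.re * x ^ (1 : ℝ)) := by
  rw [norm_mul, norm_cpow_eq_rpow_re_of_pos hx, Complex.norm_exp]
  simp

theorem continuousOn_cpow_mul_exp_neg_mul (a r : ℂ) :
    ContinuousOn (fun x : ℝ => (x : ℂ) ^ a * Complex.exp (-(r * x))) (Set.Ioi 0) := fun x hx =>
  ((continuousAt_ofReal_cpow_const x a (Or.inr (ne_of_gt hx))).mul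
    (by fun_prop)).continuousWithinAt

theorem integrableOn_cpow_mul_exp_neg_mul_Ioi {a r : ℂ} (ha : -1 < a.re) (hr : 0 < r.re) :
    IntegrableOn (fun x : ℝ => (x : ℂ) ^ a * Complex.exp (-(r * x))) (Set.Ioi 0) := by
  refine Integrable.mono' (integrableOn_rpow_mul_exp_neg_mul_rpow ha one_pos hr)
    ((continuousOn_cpow_mul_exp_neg_mul a r).aestronglyMeasurable measurableSet_Ioi) ?_
  filter_upwards [ae_restrict_mem measurableSet_Ioi] with x hx
  exact (norm_cpow_mul_exp_neg_mul hx a r).le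

theorem differentiableAt_integral_cpow_mul_exp_neg_mul_Ioi {s r : ℂ} (hs : 0 < s.re)
    (hr : 0 < r.re) :
    DifferentiableAt ℂ (fun r : ℂ => ∫ x : ℝ in Set.Ioi 0,
      (x : ℂ) ^ (s - 1) * Complex.exp (-(r * x))) r := by
  have hU : {q : ℂ | r.re / 2 < q.re} ∈ nhds r :=
    (isOpen_lt continuous_const Complex.continuous_re).mem_nhds (half_lt_self hr)
  have hs' : -1 < (s - 1).re := by simpa using hs
  refine (hasDerivAt_integral_of_dominated_loc_of_deriv_le hU
    (F' := fun q x => -((x : ℂ) ^ s * Complex.exp (-(q * x))))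
    (bound := fun x => x ^ s.re * Real.exp (-(r.re / 2) * x ^ (1 : ℝ)))
    (.of_forall fun q => (continuousOn_cpow_mul_exp_neg_mul (s - 1) q).aestronglyMeasurable
      measurableSet_Ioi)
    (integrableOn_cpow_mul_exp_neg_mul_Ioi hs' hr)
    ((continuousOn_cpow_mul_exp_neg_mul s r).neg.aestronglyMeasurable measurableSet_Ioi) ?_
    (integrableOn_rpow_mul_exp_neg_mul_rpow (by linarith) one_pos (half_pos hr))
    ?_).2.differentiableAt
  · filter_upwards [ae_restrict_mem measurableSet_Ioi] with x hx q hq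
    have hx' : 0 < x := hx
    rw [norm_neg, norm_cpow_mul_exp_neg_mul hx]
    have hq' : r.re / 2 < q.re := hq
    gcongr
  · filter_upwards [ae_restrict_mem measurableSet_Ioi] with x hx q _
    have hx0 : (x : ℂ) ≠ 0 := ofReal_ne_zero.2 (ne_of_gt hx)
    have hpow : (x : ℂ) ^ s = (x : ℂ) ^ (s - 1) * x := by
      rw [cpow_sub _ _ hx0, cpow_one, div_mul_cancel₀ _ hx0]
    have h := ((((hasDerivAt_id q).mul_const (x : ℂ)).neg).cexp).const_mul ((x : ℂ) ^ (s - 1))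
    refine h.congr_deriv ?_
    simp only [hpow, id, Pi.neg_apply]
    ring

theorem integral_cpow_mul_exp_neg_mul_Ioi_of_re_pos {s r : ℂ} (hs : 0 < s.re) (hr : 0 < r.re) :
    ∫ x : ℝ in Set.Ioi 0, (x : ℂ) ^ (s - 1) * Complex.exp (-(r * x)) =
      r ^ (-s) * Complex.Gamma s := by
  have hU : IsOpen {q : ℂ | 0 < q.re} := isOpen_lt continuous_const Complex.continuous_re
  have hleft : AnalyticOnNhd ℂ (fun r : ℂ => ∫ x : ℝ in Set.Ioi 0,
      (x : ℂ) ^ (s - 1) * Complex.exp (-(r * x))) {q : ℂ | 0 < q.re} :=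
    DifferentiableOn.analyticOnNhd (fun q hq =>
      (differentiableAt_integral_cpow_mul_exp_neg_mul_Ioi hs hq).differentiableWithinAt) hU
  have hright : AnalyticOnNhd ℂ (fun r : ℂ => r ^ (-s) * Complex.Gamma s) {q : ℂ | 0 < q.re} :=
    DifferentiableOn.analyticOnNhd (fun q hq =>
      ((differentiableAt_id.cpow_const (Or.inl hq)).mul_const _).differentiableWithinAt) hU
  refine hleft.eqOn_of_preconnected_of_frequently_eq hright
    (convex_halfSpace_re_gt 0).isPreconnected (z₀ := 1) (by simp) ?_ hr
  have htendsto : Filter.Tendsto (fun t : ℝ => (t : ℂ)) (nhdsWithin 1 {1}ᶜ)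
      (nhdsWithin 1 {1}ᶜ) := by
    refine tendsto_nhdsWithin_iff.2 ⟨?_, ?_⟩
    · exact (continuous_ofReal.tendsto' 1 1 ofReal_one).mono_left nhdsWithin_le_nhds
    · filter_upwards [self_mem_nhdsWithin] with t ht
      simpa using ht
  refine htendsto.frequently (Filter.Eventually.frequently ?_)
  filter_upwards [nhdsWithin_le_nhds (lt_mem_nhds one_pos)] with t ht
  rw [integral_cpow_mul_exp_neg_mul_Ioi hs ht, one_div, inv_cpow, ← cpow_neg]
  rw [arg_ofReal_of_nonneg ht.le]
  exact Real.pi_ne_zero.symm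

/-- The one-variable factor `x^{s-1} e^{2πixz}`, extended by zero to `x ≤ 0`. -/
def gammaKernel (s z : ℂ) : ℝ → ℂ :=
  (Set.Ioi (0 : ℝ)).indicator fun x =>
    (x : ℂ) ^ (s - 1) * Complex.exp (2 * Real.pi * Complex.I * (x * z))

theorem gammaKernel_eq (s z : ℂ) :
    gammaKernel s z = (Set.Ioi (0 : ℝ)).indicator fun x =>
      (x : ℂ) ^ (s - 1) * Complex.exp (-(((-2 : ℂ) * Real.pi * Complex.I) * z * x)) := by
  unfold gammaKernel
  congr! 4
  ring

theorem re_neg_two_pi_I_mul_pos {z : ℂ} (hz : 0 < z.im) :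
    0 < (((-2 : ℂ) * Real.pi * Complex.I) * z).re := by
  simp
  positivity

theorem integrable_gammaKernel {s z : ℂ} (hs : 0 < s.re) (hz : 0 < z.im) :
    Integrable (gammaKernel s z) := by
  rw [gammaKernel_eq, integrable_indicator_iff measurableSet_Ioi]
  exact integrableOn_cpow_mul_exp_neg_mul_Ioi (by simpa using hs) (re_neg_two_pi_I_mul_pos hz)

theorem neg_two_pi_I_mul_cpow {z : ℂ} (hz : 0 < z.im) (a : ℂ) :
    (((-2 : ℂ) * Real.pi * Complex.I) * z) ^ a =
      ((-2 : ℂ) * Real.pi * Complex.I) ^ a * z ^ a := by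
  have hz0 : z ≠ 0 := by rintro rfl; simp at hz
  have hc : ((-2 : ℂ) * Real.pi * Complex.I) = ((2 * Real.pi : ℝ) : ℂ) * (-Complex.I) := by
    push_cast; ring
  have harg : ((-2 : ℂ) * Real.pi * Complex.I).arg = -(Real.pi / 2) := by
    rw [hc, arg_real_mul _ (by positivity), arg_neg_I]
  have hc0 : ((-2 : ℂ) * Real.pi * Complex.I) ≠ 0 := by simp [Real.pi_ne_zero]
  have hzarg : 0 ≤ z.arg := arg_nonneg_iff.2 hz.le
  rw [cpow_def_of_ne_zero (mul_ne_zero hc0 hz0), cpow_def_of_ne_zero hc0,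
    cpow_def_of_ne_zero hz0, ← Complex.exp_add, Complex.log_mul hc0 hz0, add_mul]
  rw [harg]
  constructor <;> linarith [arg_le_pi z, Real.pi_pos]

theorem integral_gammaKernel {s z : ℂ} (hs : 0 < s.re) (hz : 0 < z.im) :
    ∫ x, gammaKernel s z x =
      Complex.Gamma s * ((-2 : ℂ) * Real.pi * Complex.I) ^ (-s) * z ^ (-s) := by
  rw [gammaKernel_eq, integral_indicator measurableSet_Ioi,
    integral_cpow_mul_exp_neg_mul_Ioi_of_re_pos hs (re_neg_two_pi_I_mul_pos hz),
    neg_two_pi_I_mul_cpow hz]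
  ring

theorem gammaKernel_mul_exp (s z : ℂ) (w x : ℝ) :
    gammaKernel s z x * Complex.exp (2 * Real.pi * Complex.I * (x * w)) =
      gammaKernel s (z + w) x := by
  by_cases hx : 0 < x
  · simp only [gammaKernel, Set.indicator_of_mem (Set.mem_Ioi.2 hx)]
    rw [mul_assoc, ← Complex.exp_add]
    ring_nf
  · simp [gammaKernel, hx]

/-- For `Re s > 2` and `z₁, z₂ ∈ ℍ`, the function
`f(x₁,x₂) = (x₁x₂)^{s-1} e^{2πi(x₁z₁+x₂z₂)}` on the totally positive quadrant (and `0`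
elsewhere) is integrable on `ℝ²`, and for all real `w₁, w₂`,
`∫ f(x) e^{2πi(x₁w₁+x₂w₂)} dx = (Γ(s)²/(-2πi)^{2s}) (z₁+w₁)^{-s} (z₂+w₂)^{-s}`. -/
theorem statement6 (s : ℂ) (hs : 2 < s.re)
    (z₁ z₂ : ℂ) (hz₁ : 0 < z₁.im) (hz₂ : 0 < z₂.im)
    (f : ℝ × ℝ → ℂ)
    (hf : ∀ x : ℝ × ℝ, f x =
      if 0 < x.1 ∧ 0 < x.2 then
        ((x.1 * x.2 : ℝ) : ℂ) ^ (s - 1) *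
          Complex.exp (2 * Real.pi * Complex.I * ((x.1 : ℂ) * z₁ + (x.2 : ℂ) * z₂))
      else 0) :
    Integrable f ∧
    ∀ w₁ w₂ : ℝ,
      (∫ x : ℝ × ℝ, f x *
          Complex.exp (2 * Real.pi * Complex.I * ((x.1 : ℂ) * (w₁ : ℂ) + (x.2 : ℂ) * (w₂ : ℂ))))
        = Complex.Gamma s ^ 2 / ((-2 : ℂ) * Real.pi * Complex.I) ^ (2 * s) *
            ((z₁ + (w₁ : ℂ)) ^ (-s) * (z₂ + (w₂ : ℂ)) ^ (-s)) := by
  have hs0 : 0 < s.re := by linarith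
  have hprod : f = fun x : ℝ × ℝ => gammaKernel s z₁ x.1 * gammaKernel s z₂ x.2 := by
    funext x
    rw [hf]
    split_ifs with hx
    · simp only [gammaKernel, Set.indicator_of_mem (Set.mem_Ioi.2 hx.1),
        Set.indicator_of_mem (Set.mem_Ioi.2 hx.2)]
      rw [ofReal_mul, mul_cpow_ofReal_nonneg hx.1.le hx.2.le, mul_add, Complex.exp_add]
      ring
    · rcases not_and_or.1 hx with h | h <;> simp [gammaKernel, h]
  refine ⟨?_, fun w₁ w₂ => ?_⟩
  · rw [hprod]
    exact (integrable_gammaKernel hs0 hz₁).mul_prod (integrable_gammaKernel hs0 hz₂)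
  · have hfactor : ∀ x : ℝ × ℝ, f x * Complex.exp (2 * Real.pi * Complex.I *
        ((x.1 : ℂ) * (w₁ : ℂ) + (x.2 : ℂ) * (w₂ : ℂ))) =
        gammaKernel s (z₁ + w₁) x.1 * gammaKernel s (z₂ + w₂) x.2 := by
      intro x
      rw [hprod, mul_add, Complex.exp_add, mul_mul_mul_comm, gammaKernel_mul_exp,
        gammaKernel_mul_exp]
    have hc0 : ((-2 : ℂ) * Real.pi * Complex.I) ≠ 0 := by simp [Real.pi_ne_zero]
    simp_rw [hfactor]
    rw [Measure.volume_eq_prod,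
      integral_prod_mul (gammaKernel s (z₁ + w₁)) (gammaKernel s (z₂ + w₂)),
      integral_gammaKernel hs0 (by simpa using hz₁), integral_gammaKernel hs0 (by simpa using hz₂),
      div_eq_mul_inv, ← cpow_neg, show -(2 * s) = -s + -s by ring, cpow_add _ _ hc0]
    ring

end HilbertPaper
end
end

section
/- Let k ≥ 4 be even, let s ∈ ℂ with 1 < Re(s) < k−1, and let z ∈ ℍ². Define K_{k,s}(z) = Σ_{γ ∈ A\Γ} (γ₁z₁)^{−s}(γ₂z₂)^{−s}·j(γ,z)^{−k·1} (an absolutely convergent sum over the coset space A\Γ). Then for every δ ∈ Γ, K_{k,s}(δ·z) = j(δ,z)^{k·1}·K_{k,s}(z); that is, the Cohen kernel transforms like a Hilbert modular form of parallel weight k under Γ. -/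
open Complex

noncomputable section

namespace HilbertPaper

variable (F : Type) [Field F] [NumberField F]

theorem mat_mul (σ : F →+* ℝ) (γ δ : SL2O F) : mat F σ (γ * δ) = mat F σ γ * mat F σ δ := by
  simp [mat, Matrix.map_mul]

theorem det_mat (σ : F →+* ℝ) (γ : SL2O F) : (mat F σ γ).det = 1 := by
  have h := congrArg (emb F σ) γ.det_coe
  rwa [RingHom.map_det, map_one] at h

theorem jfac_ne_zero {g : Matrix (Fin 2) (Fin 2) ℝ} (hg : g.det = 1) {z : ℂ} (hz : 0 < z.im) :
    jfac g z ≠ 0 := by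
  intro h
  have him := congrArg Complex.im h
  have hre := congrArg Complex.re h
  simp [jfac] at him hre
  rw [Matrix.det_fin_two] at hg
  have hc : g 1 0 = 0 := him.resolve_right hz.ne'
  have hd : g 1 1 = 0 := by simpa [hc] using hre
  simp [hc, hd] at hg

theorem jfac_mul (g h : Matrix (Fin 2) (Fin 2) ℝ) {z : ℂ} (hz : jfac h z ≠ 0) :
    jfac (g * h) z = jfac g (moebius h z) * jfac h z := by
  simp only [jfac, moebius, Matrix.mul_apply, Fin.sum_univ_two] at hz ⊢
  push_cast
  field_simp
  ring

theorem moebius_mul (g h : Matrix (Fin 2) (Fin 2) ℝ) {z : ℂ} (hz : jfac h z ≠ 0) :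
    moebius (g * h) z = moebius g (moebius h z) := by
  have hden := jfac_mul g h hz
  have hnum : ((g * h) 0 0 : ℂ) * z + ((g * h) 0 1 : ℂ)
      = ((g 0 0 : ℂ) * moebius h z + (g 0 1 : ℂ)) * jfac h z := by
    simp only [jfac, moebius, Matrix.mul_apply, Fin.sum_univ_two] at hz ⊢
    push_cast
    field_simp
    ring
  change _ / jfac (g * h) z = _ / jfac g (moebius h z)
  rw [hnum, hden, mul_div_mul_right _ _ hz]

theorem cohenSummand_moebius (σ₁ σ₂ : F →+* ℝ) (k : ℕ) (s : ℂ) {z₁ z₂ : ℂ}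
    (hz₁ : 0 < z₁.im) (hz₂ : 0 < z₂.im) (γ δ : SL2O F) :
    cohenSummand F σ₁ σ₂ k s (moebius (mat F σ₁ δ) z₁) (moebius (mat F σ₂ δ) z₂) γ
      = (jfac (mat F σ₁ δ) z₁ ^ (k : ℤ) * jfac (mat F σ₂ δ) z₂ ^ (k : ℤ)) *
          cohenSummand F σ₁ σ₂ k s z₁ z₂ (γ * δ) := by
  have h₁ := jfac_ne_zero (det_mat F σ₁ δ) hz₁
  have h₂ := jfac_ne_zero (det_mat F σ₂ δ) hz₂
  have cancel : ∀ x y : ℂ, y ≠ 0 → x ^ (-(k : ℤ)) = y ^ (k : ℤ) * (x * y) ^ (-(k : ℤ)) := by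
    intro x y hy
    rw [mul_zpow, mul_left_comm, ← zpow_add₀ hy]
    simp
  simp only [cohenSummand, mat_mul, moebius_mul _ _ h₁, moebius_mul _ _ h₂, jfac_mul _ _ h₁,
    jfac_mul _ _ h₂]
  rw [cancel (jfac (mat F σ₁ γ) _) _ h₁, cancel (jfac (mat F σ₂ γ) _) _ h₂]
  ring

/-- Right multiplication by `δ` on the coset space `A\Γ`. -/
def mulRightQuot (σ₁ σ₂ : F →+* ℝ) (δ : SL2O F) :
    Quot (ARel F σ₁ σ₂) ≃ Quot (ARel F σ₁ σ₂) :=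
  Quot.congr (Equiv.mulRight δ) fun γ γ' => by
    simp only [ARel, Equiv.coe_mulRight, ← mul_assoc, mul_left_inj]

/-- For even `k ≥ 4`, `1 < Re s < k - 1`, the Cohen kernel
`K_{k,s}(z) = Σ_{γ ∈ A\Γ} (γ₁z₁)^{-s}(γ₂z₂)^{-s} j(γ,z)^{-k·1}` satisfies
`K_{k,s}(δ·z) = j(δ,z)^{k·1} K_{k,s}(z)` for every `δ ∈ Γ`.  Here `K` is any family of
functions on the coset space `A\Γ` induced by the summand (as a function of `z ∈ ℍ²`). -/
theorem statement7 (σ₁ σ₂ : F →+* ℝ) (hF : RealQuadNarrowOne F σ₁ σ₂)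
    (k : ℕ) (hkeven : Even k) (hk4 : 4 ≤ k)
    (s : ℂ) (hs1 : 1 < s.re) (hs2 : s.re < (k : ℝ) - 1)
    (K : ℂ → ℂ → Quot (ARel F σ₁ σ₂) → ℂ)
    (hK : ∀ (u₁ u₂ : ℂ) (γ : SL2O F),
      K u₁ u₂ (Quot.mk _ γ) = cohenSummand F σ₁ σ₂ k s u₁ u₂ γ)
    (z₁ z₂ : ℂ) (hz₁ : 0 < z₁.im) (hz₂ : 0 < z₂.im)
    (δ : SL2O F) :
    (∑' q, K (moebius (mat F σ₁ δ) z₁) (moebius (mat F σ₂ δ) z₂) q)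
      = (jfac (mat F σ₁ δ) z₁ ^ (k : ℤ) * jfac (mat F σ₂ δ) z₂ ^ (k : ℤ)) *
          ∑' q, K z₁ z₂ q := by
  rw [← (mulRightQuot F σ₁ σ₂ δ).tsum_eq (K z₁ z₂), ← tsum_mul_left]
  refine tsum_congr fun q => ?_
  induction q using Quot.ind with
  | mk γ =>
    rw [hK, cohenSummand_moebius F σ₁ σ₂ k s hz₁ hz₂, ← hK]
    rfl

end HilbertPaper
end
end
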